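/- arXiv:2007.00532 — 3 statements merged into one kernel-verified Lean document; each statement's English description precedes it below -/
import Mathlib

section
/- For every g ≥ 3, the abelianisation of the group O_{g,g}(ℤ) is isomorphic to (ℤ/2) × (ℤ/2). (Equivalently, H₁(O_{g,g}(ℤ); ℤ) ≅ (ℤ/2)² for g ≥ 3.) -/
open Matrix

/-- The Gram matrix of the hyperbolic symmetric bilinear form of rank `2g`: block-diagonal with
`g` blocks `[[0,1],[1,0]]`, with indices `(i, 0), (i, 1)` forming the `i`-th block. -/
def Qmat (g : ℕ) : Matrix (Fin g × Fin 2) (Fin g × Fin 2) ℤ :=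
  Matrix.of fun p q => if p.1 = q.1 ∧ p.2 ≠ q.2 then 1 else 0

namespace HyperbolicOrthogonal

variable {g : ℕ}

/-- The index of the basis vector dual to the one with index `p`. -/
def dual (p : Fin g × Fin 2) : Fin g × Fin 2 := (p.1, p.2 + 1)

@[simp] lemma dual_fst (p : Fin g × Fin 2) : (dual p).1 = p.1 := rfl

@[simp] lemma dual_dual (p : Fin g × Fin 2) : dual (dual p) = p := by
  obtain ⟨i, e⟩ := p
  fin_cases e <;> simp [dual]

lemma dual_ne (p : Fin g × Fin 2) : dual p ≠ p := by
  obtain ⟨i, e⟩ := p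
  fin_cases e <;> simp [dual]

lemma dual_eq_iff {p q : Fin g × Fin 2} : dual p = q ↔ p = dual q :=
  ⟨fun h => by rw [← h, dual_dual], fun h => by rw [h, dual_dual]⟩

lemma eq_or_eq_dual {p q : Fin g × Fin 2} (h : p.1 = q.1) : p = q ∨ p = dual q := by
  obtain ⟨i, e⟩ := p
  obtain ⟨j, f⟩ := q
  obtain rfl : i = j := h
  fin_cases e <;> fin_cases f <;> simp [dual]

lemma Qmat_apply (p q : Fin g × Fin 2) : Qmat g p q = if p = dual q then 1 else 0 := by
  obtain ⟨i, e⟩ := p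
  obtain ⟨j, f⟩ := q
  fin_cases e <;> fin_cases f <;> simp [Qmat, dual]

lemma Qmat_mul_apply {n : Type*} (M : Matrix (Fin g × Fin 2) n ℤ) (p : Fin g × Fin 2) (q : n) :
    (Qmat g * M) p q = M (dual p) q := by
  simp [Matrix.mul_apply, Qmat_apply, ← dual_eq_iff]

lemma mul_Qmat_apply {n : Type*} (M : Matrix n (Fin g × Fin 2) ℤ) (p : n) (q : Fin g × Fin 2) :
    (M * Qmat g) p q = M p (dual q) := by
  simp [Matrix.mul_apply, Qmat_apply]

lemma Qmat_mul_Qmat : Qmat g * Qmat g = 1 := by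
  ext p q
  simp [Qmat_mul_apply, Qmat_apply, Matrix.one_apply, dual_eq_iff]

lemma Qmat_mul_single (a b : Fin g × Fin 2) (c : ℤ) :
    Qmat g * Matrix.single a b c = Matrix.single (dual a) b c := by
  ext p q
  simp [Qmat_mul_apply, Matrix.single_apply, dual_eq_iff]

lemma single_mul_Qmat (a b : Fin g × Fin 2) (c : ℤ) :
    Matrix.single a b c * Qmat g = Matrix.single a (dual b) c := by
  ext p q
  simp [mul_Qmat_apply, Matrix.single_apply, dual_eq_iff]

variable (g) in
/-- The group `O_{g,g}(ℤ)`. -/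
def orthogonalGroup : Subgroup (GL (Fin g × Fin 2) ℤ) where
  carrier := {M | M.valᵀ * Qmat g * M.val = Qmat g}
  one_mem' := by simp
  mul_mem' {M N} (hM : M.valᵀ * Qmat g * M.val = Qmat g)
      (hN : N.valᵀ * Qmat g * N.val = Qmat g) := by
    change (M.val * N.val)ᵀ * Qmat g * (M.val * N.val) = Qmat g
    rw [Matrix.transpose_mul, show N.valᵀ * M.valᵀ * Qmat g * (M.val * N.val) =
      N.valᵀ * (M.valᵀ * Qmat g * M.val) * N.val by noncomm_ring, hM, hN]
  inv_mem' {M} (hM : M.valᵀ * Qmat g * M.val = Qmat g) := by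
    change M⁻¹.valᵀ * Qmat g * M⁻¹.val = Qmat g
    have h : M.val * M⁻¹.val = 1 := M.mul_inv
    have h' : M⁻¹.valᵀ * M.valᵀ = 1 := by rw [← Matrix.transpose_mul, h, Matrix.transpose_one]
    nth_rw 1 [← hM]
    rw [show M⁻¹.valᵀ * (M.valᵀ * Qmat g * M.val) * M⁻¹.val =
      (M⁻¹.valᵀ * M.valᵀ) * Qmat g * (M.val * M⁻¹.val) by noncomm_ring, h, h', one_mul, mul_one]

/-- The underlying matrix of an element of `O_{g,g}(ℤ)`. -/
def mat (M : orthogonalGroup g) : Matrix (Fin g × Fin 2) (Fin g × Fin 2) ℤ := M.1.val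

@[simp] lemma mat_one : mat (1 : orthogonalGroup g) = 1 := rfl

@[simp] lemma mat_mul (M N : orthogonalGroup g) : mat (M * N) = mat M * mat N := rfl

lemma mat_injective : Function.Injective (mat (g := g)) :=
  fun _ _ h => Subtype.ext (Units.ext h)

lemma mat_form (M : orthogonalGroup g) : (mat M)ᵀ * Qmat g * mat M = Qmat g := M.2

/-- A matrix preserving the hyperbolic form is an element of `O_{g,g}(ℤ)`. -/
def ofMatrix (M : Matrix (Fin g × Fin 2) (Fin g × Fin 2) ℤ) (h : Mᵀ * Qmat g * M = Qmat g) :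
    orthogonalGroup g :=
  have h1 : Qmat g * Mᵀ * Qmat g * M = 1 := by
    rw [mul_assoc, mul_assoc, ← mul_assoc Mᵀ, h, Qmat_mul_Qmat]
  ⟨⟨M, Qmat g * Mᵀ * Qmat g, mul_eq_one_comm.mp h1, h1⟩, h⟩

@[simp] lemma mat_ofMatrix (M : Matrix (Fin g × Fin 2) (Fin g × Fin 2) ℤ)
    (h : Mᵀ * Qmat g * M = Qmat g) : mat (ofMatrix M h) = M := rfl

lemma sum_mat_mul_mat (M : orthogonalGroup g) (p q : Fin g × Fin 2) :
    ∑ r, mat M (dual r) p * mat M r q = if p = dual q then 1 else 0 := by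
  rw [← Qmat_apply, ← mat_form M, Matrix.mul_apply]
  simp [mul_Qmat_apply]

lemma isUnit_of_dvd_col (M : orthogonalGroup g) (p : Fin g × Fin 2) (d : ℤ)
    (h : ∀ q, d ∣ mat M q p) : IsUnit d := by
  have h1 := sum_mat_mul_mat M (dual p) p
  rw [if_pos rfl] at h1
  exact isUnit_of_dvd_one (h1 ▸ Finset.dvd_sum fun r _ => (h r).mul_left _)

/-- The matrix of the Eichler transvection adding `c` times the coordinate `b` to the
coordinate `a`. -/
def transvectionMatrix (a b : Fin g × Fin 2) (c : ℤ) : Matrix (Fin g × Fin 2) (Fin g × Fin 2) ℤ :=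
  1 + Matrix.single a b c - Matrix.single (dual b) (dual a) c

lemma transvectionMatrix_form {a b : Fin g × Fin 2} (h : a.1 ≠ b.1) (c : ℤ) :
    (transvectionMatrix a b c)ᵀ * Qmat g * transvectionMatrix a b c = Qmat g := by
  have h2 : a ≠ b := fun e => h (by rw [e])
  have h3 : dual b ≠ dual a := fun e => h2 (by rw [← dual_dual a, ← e, dual_dual])
  simp only [transvectionMatrix, Matrix.transpose_sub, Matrix.transpose_add,
    Matrix.transpose_one, Matrix.transpose_single, mul_add, add_mul, mul_sub, sub_mul, one_mul,
    mul_one, single_mul_Qmat, Qmat_mul_single, dual_dual]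
  simp [h2.symm, h3.symm, dual_ne, (dual_ne _).symm]

/-- Eichler transvections, as elements of `O_{g,g}(ℤ)`. -/
def transvection (a b : Fin g × Fin 2) (h : a.1 ≠ b.1) (c : ℤ) : orthogonalGroup g :=
  ofMatrix (transvectionMatrix a b c) (transvectionMatrix_form h c)

lemma transvection_mul_apply (a b : Fin g × Fin 2) (h : a.1 ≠ b.1) (c : ℤ)
    (M : orthogonalGroup g) (r q : Fin g × Fin 2) :
    mat (transvection a b h c * M) r q = mat M r q + (if r = a then c * mat M b q else 0)
      - (if r = dual b then c * mat M (dual a) q else 0) := by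
  simp [transvection, transvectionMatrix, add_mul, sub_mul, Matrix.single_mul_eq_updateRow_zero,
    Matrix.updateRow_apply]

lemma transvection_mul_transvection {a b d : Fin g × Fin 2} (hab : a.1 ≠ b.1) (hbd : b.1 ≠ d.1)
    (had : a.1 ≠ d.1) (c : ℤ) :
    transvection a b hab c * transvection b d hbd 1 =
      transvection a d had c * transvection b d hbd 1 * transvection a b hab c := by
  have h1 : ∀ {x y : Fin g × Fin 2}, x.1 ≠ y.1 → x ≠ y := fun h e => h (by rw [e])
  have h2 : ∀ {x y : Fin g × Fin 2}, x.1 ≠ y.1 → dual x ≠ y := fun h e => h (by rw [← e, dual_fst])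
  have h3 : ∀ {x y : Fin g × Fin 2}, x.1 ≠ y.1 → x ≠ dual y := fun h e => h (by rw [e, dual_fst])
  have h4 : ∀ {x y : Fin g × Fin 2}, x.1 ≠ y.1 → dual x ≠ dual y := fun h => h2 h
  apply mat_injective
  simp only [transvection, mat_mul, mat_ofMatrix, transvectionMatrix, mul_add, add_mul, mul_sub,
    sub_mul, one_mul, mul_one]
  simp [h2 hab, h3 hbd, h4 hab, h4 had, h1 hbd.symm, h1 had.symm, h2 hab.symm, h3 hbd.symm,
    dual_ne, (dual_ne _).symm]
  abel

lemma transvection_mem_commutator (hg : 3 ≤ g) (a b : Fin g × Fin 2) (h : a.1 ≠ b.1) (c : ℤ) :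
    transvection a b h c ∈ commutator (orthogonalGroup g) := by
  obtain ⟨k, -, hk⟩ := Finset.exists_mem_notMem_of_card_lt_card
    (s := {a.1, b.1}) (t := (Finset.univ : Finset (Fin g)))
    (Finset.card_le_two.trans_lt (by simpa using Nat.lt_of_succ_le hg))
  simp only [Finset.mem_insert, Finset.mem_singleton, not_or] at hk
  have e := transvection_mul_transvection (a := a) (b := (k, 0)) (d := b) (Ne.symm hk.1) hk.2 h c
  rw [mul_assoc, ← mul_inv_eq_iff_eq_mul, _root_.mul_inv_rev, ← mul_assoc,
    ← commutatorElement_def] at e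
  exact e ▸ Subgroup.commutator_mem_commutator (Subgroup.mem_top _) (Subgroup.mem_top _)

/-- The elements of `O_{g,g}(ℤ)` fixing the standard basis vectors with index in `S`. -/
def fixer (S : Set (Fin g × Fin 2)) : Subgroup (orthogonalGroup g) where
  carrier := {M | ∀ p ∈ S, mat M *ᵥ Pi.single p 1 = Pi.single p 1}
  one_mem' p _ := by rw [mat_one, Matrix.one_mulVec]
  mul_mem' {M N} hM hN p hp := by
    rw [mat_mul, ← Matrix.mulVec_mulVec, hN p hp, hM p hp]
  inv_mem' {M} hM p hp := by
    nth_rw 1 [← hM p hp]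
    rw [Matrix.mulVec_mulVec, ← mat_mul, inv_mul_cancel, mat_one, Matrix.one_mulVec]

lemma mem_fixer_iff {S : Set (Fin g × Fin 2)} {M : orthogonalGroup g} :
    M ∈ fixer S ↔ ∀ p ∈ S, ∀ r, mat M r p = if r = p then 1 else 0 := by
  change (∀ p ∈ S, mat M *ᵥ Pi.single p 1 = Pi.single p 1) ↔ _
  simp [funext_iff, Pi.single_apply, Matrix.col_apply]

lemma fixer_row {S : Set (Fin g × Fin 2)} {M : orthogonalGroup g} (hM : M ∈ fixer S)
    {p : Fin g × Fin 2} (hp : dual p ∈ S) (q : Fin g × Fin 2) :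
    mat M p q = if p = q then 1 else 0 := by
  have h := sum_mat_mul_mat M (dual p) q
  simpa [mem_fixer_iff.mp hM _ hp, dual_eq_iff] using h

lemma transvection_mem_fixer {S : Set (Fin g × Fin 2)} {a b : Fin g × Fin 2} (h : a.1 ≠ b.1)
    (c : ℤ) (hb : b ∉ S) (ha : dual a ∉ S) : transvection a b h c ∈ fixer S := by
  rw [mem_fixer_iff]
  intro p hp r
  have h1 : b ≠ p := fun e => hb (e ▸ hp)
  have h2 : dual a ≠ p := fun e => ha (e ▸ hp)
  simpa [Matrix.one_apply, h1, h2] using transvection_mul_apply a b h c 1 r p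

lemma exists_mul_apply_eq_zero (hg : 3 ≤ g) {S : Set (Fin g × Fin 2)} {b : Fin g × Fin 2}
    (hb : b ∉ S) {M : orthogonalGroup g} (hM : M ∈ fixer S) (n : ℤ)
    (hn : ∃ N ∈ commutator (orthogonalGroup g) ⊓ fixer S, mat (N * M) b b = n)
    (hdvd : ∀ N ∈ commutator (orthogonalGroup g) ⊓ fixer S, mat (N * M) b b = n →
      ∀ p : Fin g × Fin 2, p.1 ≠ b.1 → dual p ∉ S → n ∣ mat (N * M) p b) :
    ∃ N ∈ commutator (orthogonalGroup g) ⊓ fixer S, mat (N * M) b b = n ∧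
      ∀ p : Fin g × Fin 2, p.1 ≠ b.1 → mat (N * M) p b = 0 := by
  suffices ∀ t : Finset (Fin g × Fin 2), ∃ N ∈ commutator (orthogonalGroup g) ⊓ fixer S,
      mat (N * M) b b = n ∧ ∀ p ∈ t, p.1 ≠ b.1 → mat (N * M) p b = 0 by
    simpa using this Finset.univ
  intro t
  induction t using Finset.induction_on with
  | empty => simpa using hn
  | insert p t hpt ih =>
    obtain ⟨N, hN, hNn, hNt⟩ := ih
    by_cases hpb : p.1 = b.1
    · exact ⟨N, hN, hNn, by simpa [hpb] using hNt⟩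
    by_cases hpS : dual p ∈ S
    · refine ⟨N, hN, hNn, ?_⟩
      have h1 := fixer_row (mul_mem hN.2 hM) hpS b
      rw [if_neg (fun e => hpb (by rw [e]))] at h1
      simp only [Finset.mem_insert, forall_eq_or_imp]
      exact ⟨fun _ => h1, hNt⟩
    obtain ⟨c, hc⟩ := hdvd N hN hNn p hpb hpS
    refine ⟨transvection p b hpb (-c) * N, mul_mem ⟨transvection_mem_commutator hg _ _ _ _,
      transvection_mem_fixer _ _ hb hpS⟩ hN, ?_, ?_⟩
    · rw [mul_assoc, transvection_mul_apply, if_neg (fun e => hpb (by rw [e])),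
        if_neg (dual_ne b).symm, hNn]
      ring
    · intro q hq hqb
      rw [mul_assoc, transvection_mul_apply, hNn,
        if_neg (c := q = dual b) (fun e => hqb (by rw [e, dual_fst]))]
      split_ifs with hqp
      · rw [hqp, hc]
        ring
      · rw [hNt q ((Finset.mem_insert.mp hq).resolve_left hqp) hqb]
        ring

lemma mem_fixer_of_apply_eq_zero {M : orthogonalGroup g} {b : Fin g × Fin 2}
    (hpos : 0 < mat M b b) (h0 : ∀ p : Fin g × Fin 2, p.1 ≠ b.1 → mat M p b = 0) :
    M ∈ fixer {b} := by
  have h1 : mat M (dual b) b = 0 := by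
    have h := sum_mat_mul_mat M b b
    rw [if_neg (dual_ne b).symm, Fintype.sum_eq_add b (dual b) (dual_ne b).symm, dual_dual] at h
    · have : mat M b b * mat M (dual b) b = 0 := by linarith
      exact (mul_eq_zero.mp this).resolve_left hpos.ne'
    · rintro r ⟨hr, hr'⟩
      rw [h0 r fun e => (eq_or_eq_dual e).elim hr hr', mul_zero]
  have h2 : ∀ p, p ≠ b → mat M p b = 0 := fun p hp => by
    by_cases e : p.1 = b.1
    · rw [(eq_or_eq_dual e).resolve_left hp, h1]
    · exact h0 p e
  have h3 : mat M b b = 1 := by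
    have := isUnit_of_dvd_col M b (mat M b b) fun q => by
      by_cases e : q = b
      · rw [e]
      · simp [h2 q e]
    rcases Int.isUnit_iff.mp this with h | h <;> omega
  rw [mem_fixer_iff]
  rintro _ rfl r
  split_ifs with e
  · rw [e, h3]
  · exact h2 r e

lemma fixer_insert {S : Set (Fin g × Fin 2)} {b : Fin g × Fin 2} {M : orthogonalGroup g}
    (h : M ∈ fixer S) (h' : M ∈ fixer {b}) : M ∈ fixer (insert b S) := by
  rw [mem_fixer_iff] at *
  rintro p (rfl | hp)
  · exact h' _ rfl
  · exact h p hp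

lemma exists_pos (hg : 3 ≤ g) {s : Set (Fin g)} {k z : Fin g} (hk : k ∉ s) (hz : z ∉ s)
    (hkz : k ≠ z) {M : orthogonalGroup g} (hM : M ∈ fixer (Prod.fst ⁻¹' s)) :
    ∃ N ∈ commutator (orthogonalGroup g) ⊓ fixer (Prod.fst ⁻¹' s),
      0 < mat (N * M) (k, 0) (k, 0) := by
  have key : ∀ M ∈ fixer (Prod.fst ⁻¹' s), ∀ p : Fin g × Fin 2, p.1 ≠ k → mat M p (k, 0) ≠ 0 →
      ∃ N ∈ commutator (orthogonalGroup g) ⊓ fixer (Prod.fst ⁻¹' s),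
        0 < mat (N * M) (k, 0) (k, 0) := by
    intro M hM p hpk hp
    have hps : p.1 ∉ s := fun h => by
      have := fixer_row hM (p := p) h (k, 0)
      rw [if_neg (fun e => hpk (by rw [e]))] at this
      exact hp this
    refine ⟨transvection (k, 0) p hpk.symm (mat M p (k, 0) * (|mat M (k, 0) (k, 0)| + 1)),
      ⟨transvection_mem_commutator hg _ _ _ _, transvection_mem_fixer _ _ hps hk⟩, ?_⟩
    rw [transvection_mul_apply, if_pos rfl,
      if_neg (fun e => hpk (by rw [dual_eq_iff.mp e.symm]; rfl))]
    have h1 := neg_abs_le (mat M (k, 0) (k, 0))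
    have h2 := abs_nonneg (mat M (k, 0) (k, 0))
    have h3 : 0 < mat M p (k, 0) ^ 2 := by positivity
    nlinarith
  by_cases h : ∃ p : Fin g × Fin 2, p.1 ≠ k ∧ mat M p (k, 0) ≠ 0
  · obtain ⟨p, hp, hp'⟩ := h
    exact key M hM p hp hp'
  push Not at h
  obtain ⟨e, he⟩ : ∃ e, mat M (k, e) (k, 0) ≠ 0 := by
    by_contra! h'
    have := isUnit_of_dvd_col M (k, 0) 0 fun q => by
      by_cases hq : q.1 = k
      · rw [← h' q.2, ← hq]
      · rw [h q hq]
    simp at this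
  have hT : transvection (z, 0) (k, e) hkz.symm 1 ∈
      commutator (orthogonalGroup g) ⊓ fixer (Prod.fst ⁻¹' s) :=
    ⟨transvection_mem_commutator hg _ _ _ _, transvection_mem_fixer _ _ hk hz⟩
  obtain ⟨N, hN, hN'⟩ := key (transvection (z, 0) (k, e) hkz.symm 1 * M) (mul_mem hT.2 hM) (z, 0)
    hkz.symm (by
      rw [transvection_mul_apply, if_pos rfl, if_neg (fun e => hkz (congrArg Prod.fst e).symm),
        h _ hkz.symm]
      simpa using he)
  exact ⟨_, mul_mem hN hT, by rwa [mul_assoc]⟩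

lemma exists_fix_first (hg : 3 ≤ g) {s : Set (Fin g)} {k z : Fin g} (hk : k ∉ s) (hz : z ∉ s)
    (hkz : k ≠ z) {M : orthogonalGroup g} (hM : M ∈ fixer (Prod.fst ⁻¹' s)) :
    ∃ N ∈ commutator (orthogonalGroup g),
      N * M ∈ fixer (insert (k, 0) (Prod.fst ⁻¹' s)) := by
  have hex : ∃ n : ℕ, 0 < n ∧ ∃ N ∈ commutator (orthogonalGroup g) ⊓ fixer (Prod.fst ⁻¹' s),
      mat (N * M) (k, 0) (k, 0) = n := by
    obtain ⟨N, hN, hpos⟩ := exists_pos hg hk hz hkz hM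
    exact ⟨(mat (N * M) (k, 0) (k, 0)).toNat, by omega, N, hN, by omega⟩
  classical
  obtain ⟨hpos, hN⟩ := Nat.find_spec hex
  have hmin : ∀ N ∈ commutator (orthogonalGroup g) ⊓ fixer (Prod.fst ⁻¹' s),
      0 < mat (N * M) (k, 0) (k, 0) → (Nat.find hex : ℤ) ≤ mat (N * M) (k, 0) (k, 0) := by
    intro N hN hp
    have := Nat.find_min' hex (m := (mat (N * M) (k, 0) (k, 0)).toNat)
      ⟨by omega, N, hN, by omega⟩
    omega
  generalize Nat.find hex = n at *
  obtain ⟨N, hN, hNn, hN0⟩ := exists_mul_apply_eq_zero hg (b := (k, 0)) hk hM n hN (by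
    intro N hN hNn p hpk hps
    by_contra hnd
    set x := mat (N * M) p (k, 0) with hx
    have hr : 0 < x % n := by
      have := Int.emod_nonneg x (b := n) (by omega)
      have := mt Int.dvd_of_emod_eq_zero hnd
      omega
    have hrn : x % n < n := Int.emod_lt_of_pos x (by omega)
    set r := x % n
    have hT1 : transvection p (k, 0) hpk (-(x / n)) ∈
        commutator (orthogonalGroup g) ⊓ fixer (Prod.fst ⁻¹' s) :=
      ⟨transvection_mem_commutator hg _ _ _ _, transvection_mem_fixer _ _ hk hps⟩
    have hT2 : transvection (k, 0) p hpk.symm (-((n - 1) / r)) ∈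
        commutator (orthogonalGroup g) ⊓ fixer (Prod.fst ⁻¹' s) :=
      ⟨transvection_mem_commutator hg _ _ _ _, transvection_mem_fixer _ _ hps hk⟩
    have e1 : mat (transvection p (k, 0) hpk (-(x / n)) * (N * M)) p (k, 0) = r := by
      rw [transvection_mul_apply, if_pos rfl, if_neg (fun e => hpk (by rw [e, dual_fst])), hNn,
        ← hx]
      have := Int.emod_add_mul_ediv x n
      linarith
    have e2 : mat (transvection p (k, 0) hpk (-(x / n)) * (N * M)) (k, 0) (k, 0) = n := by
      rw [transvection_mul_apply, if_neg (fun e => hpk (by rw [← e])), if_neg (dual_ne _).symm, hNn]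
      ring
    have e3 : mat (transvection (k, 0) p hpk.symm (-((n - 1) / r)) *
        (transvection p (k, 0) hpk (-(x / n)) * (N * M))) (k, 0) (k, 0) = (n - 1) % r + 1 := by
      rw [transvection_mul_apply, if_pos rfl,
        if_neg (fun e => hpk (by rw [dual_eq_iff.mp e.symm]; rfl)), e1, e2]
      have := Int.emod_add_mul_ediv (n - 1 : ℤ) r
      linarith
    have h1 := Int.emod_nonneg (n - 1 : ℤ) hr.ne'
    have h2 := Int.emod_lt_of_pos (n - 1 : ℤ) hr
    have := hmin _ (mul_mem hT2 (mul_mem hT1 hN)) (by rw [mul_assoc, mul_assoc, e3]; omega)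
    rw [mul_assoc, mul_assoc, e3] at this
    omega)
  exact ⟨N, hN.1, fixer_insert (mul_mem hN.2 hM)
    (mem_fixer_of_apply_eq_zero (by omega) hN0)⟩

lemma exists_fix_second (hg : 3 ≤ g) {s : Set (Fin g)} {k : Fin g} (hk : k ∉ s)
    {M : orthogonalGroup g} (hM : M ∈ fixer (insert (k, 0) (Prod.fst ⁻¹' s))) :
    ∃ N ∈ commutator (orthogonalGroup g),
      N * M ∈ fixer (insert (k, 1) (insert (k, 0) (Prod.fst ⁻¹' s))) := by
  have h1 : ∀ M ∈ fixer (insert (k, 0) (Prod.fst ⁻¹' s)), mat M (k, 1) (k, 1) = 1 := fun M hM => by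
    simpa using fixer_row hM (p := (k, 1)) (Set.mem_insert _ _) (k, 1)
  obtain ⟨N, hN, hN1, hN0⟩ := exists_mul_apply_eq_zero hg (b := (k, 1)) (by simpa using hk) hM 1
    ⟨1, one_mem _, by simpa using h1 M hM⟩ (fun _ _ _ _ _ _ => one_dvd _)
  exact ⟨N, hN.1, fixer_insert (mul_mem hN.2 hM) (mem_fixer_of_apply_eq_zero (by omega) hN0)⟩

lemma exists_commutator_mul_mem_fixer (hg : 3 ≤ g) (z : Fin g) (M : orthogonalGroup g)
    (s : Finset (Fin g)) (hz : z ∉ s) :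
    ∃ N ∈ commutator (orthogonalGroup g), N * M ∈ fixer (Prod.fst ⁻¹' (s : Set (Fin g))) := by
  induction s using Finset.induction_on with
  | empty => exact ⟨1, one_mem _, by simp [mem_fixer_iff]⟩
  | insert k s hk ih =>
    simp only [Finset.mem_insert, not_or] at hz
    obtain ⟨N₀, hN₀, h₀⟩ := ih hz.2
    obtain ⟨N₁, hN₁, h₁⟩ := exists_fix_first hg (by simpa using hk) (by simpa using hz.2)
      (Ne.symm hz.1) h₀
    obtain ⟨N₂, hN₂, h₂⟩ := exists_fix_second hg (by simpa using hk) h₁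
    refine ⟨N₂ * (N₁ * N₀), mul_mem hN₂ (mul_mem hN₁ hN₀), ?_⟩
    rw [mul_assoc, mul_assoc]
    rw [mem_fixer_iff] at h₂ ⊢
    rintro ⟨i, e⟩ hi
    refine h₂ _ ?_
    simp only [Finset.coe_insert, Set.mem_preimage, Set.mem_insert_iff] at hi ⊢
    fin_cases e <;> rcases hi with rfl | hi <;> simp_all

section Sign

variable (g) (R : Type*) [CommRing R]

/-- The matrix whose `i`-th column is the sum of the two basis vectors of the `i`-th block. Its
columns form an orthogonal basis of a maximal positive definite subspace. -/
def positiveBasis : Matrix (Fin g × Fin 2) (Fin g) R :=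
  Matrix.of fun p i => if p.1 = i then 1 else 0

variable {g R}

lemma positiveBasis_transpose_mul : (positiveBasis g R)ᵀ * positiveBasis g R = 2 := by
  ext i j
  rw [← Nat.cast_ofNat (R := Matrix (Fin g) (Fin g) R), ← Matrix.diagonal_natCast]
  simp [Matrix.mul_apply, positiveBasis, Fintype.sum_prod_type, Matrix.diagonal_apply, eq_comm]
  split_ifs <;> simp

lemma positiveBasis_mul_transpose :
    positiveBasis g R * (positiveBasis g R)ᵀ = 1 + (Qmat g).map (Int.castRingHom R) := by
  ext ⟨i, e⟩ ⟨j, f⟩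
  fin_cases e <;> fin_cases f <;>
    simp [Matrix.mul_apply, positiveBasis, Qmat, Matrix.one_apply, eq_comm]

lemma dotProduct_Qmat_mulVec (v : Fin g × Fin 2 → R) :
    v ⬝ᵥ (Qmat g).map (Int.castRingHom R) *ᵥ v =
      (positiveBasis g R)ᵀ *ᵥ v ⬝ᵥ (positiveBasis g R)ᵀ *ᵥ v - v ⬝ᵥ v := by
  rw [eq_sub_of_add_eq' (positiveBasis_mul_transpose (g := g) (R := R)).symm, Matrix.sub_mulVec,
    Matrix.one_mulVec, dotProduct_sub, ← Matrix.mulVec_mulVec, Matrix.dotProduct_mulVec v,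
    ← Matrix.mulVec_transpose]

lemma mulVec_dotProduct_mulVec {n : Type*} [Fintype n] {A B : Matrix n n R}
    (hA : Aᵀ * B * A = B) (x : n → R) : A *ᵥ x ⬝ᵥ B *ᵥ (A *ᵥ x) = x ⬝ᵥ B *ᵥ x := by
  nth_rw 2 [← hA]
  rw [← Matrix.mulVec_mulVec, ← Matrix.mulVec_mulVec, Matrix.dotProduct_mulVec x,
    Matrix.vecMul_transpose]

lemma positiveBasis_transpose_mulVec_ne_zero {A : Matrix (Fin g × Fin 2) (Fin g × Fin 2) ℝ}
    (hA : Aᵀ * (Qmat g).map (Int.castRingHom ℝ) * A = (Qmat g).map (Int.castRingHom ℝ))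
    {x : Fin g × Fin 2 → ℝ} (hx : 0 < x ⬝ᵥ (Qmat g).map (Int.castRingHom ℝ) *ᵥ x) :
    (positiveBasis g ℝ)ᵀ *ᵥ (A *ᵥ x) ≠ 0 := by
  intro h
  rw [← mulVec_dotProduct_mulVec hA, dotProduct_Qmat_mulVec, h] at hx
  have := dotProduct_self_star_nonneg (A *ᵥ x)
  simp at hx this
  linarith

lemma det_positiveBasis_ne_zero {A B : Matrix (Fin g × Fin 2) (Fin g × Fin 2) ℝ}
    (hA : Aᵀ * (Qmat g).map (Int.castRingHom ℝ) * A = (Qmat g).map (Int.castRingHom ℝ))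
    (hB : Bᵀ * (Qmat g).map (Int.castRingHom ℝ) * B = (Qmat g).map (Int.castRingHom ℝ))
    {t : ℝ} (ht : t ∈ Set.Icc (0 : ℝ) 1) :
    ((positiveBasis g ℝ)ᵀ * A * (t • 1 + (1 - t) • (positiveBasis g ℝ * (positiveBasis g ℝ)ᵀ)) *
      B * positiveBasis g ℝ).det ≠ 0 := by
  intro h
  obtain ⟨v, hv0, hv⟩ := Matrix.exists_mulVec_eq_zero_iff.mpr h
  simp only [← Matrix.mulVec_mulVec] at hv
  refine positiveBasis_transpose_mulVec_ne_zero hA ?_ hv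
  set U := positiveBasis g ℝ with hU
  set w := B *ᵥ (U *ᵥ v) with hw
  have hUU : ∀ y, Uᵀ *ᵥ (U *ᵥ y) = (2 : ℝ) • y := fun y => by
    rw [Matrix.mulVec_mulVec, hU, positiveBasis_transpose_mul]
    ext i
    simp [Matrix.ofNat_mulVec]
  have hUdot : ∀ y z, U *ᵥ y ⬝ᵥ z = y ⬝ᵥ Uᵀ *ᵥ z := fun y z => by
    rw [Matrix.dotProduct_mulVec, Matrix.vecMul_transpose]
  have hvv : 0 < v ⬝ᵥ v := by
    have := dotProduct_star_self_pos_iff.mpr hv0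
    simpa using this
  have hw0 : w ⬝ᵥ w < Uᵀ *ᵥ w ⬝ᵥ Uᵀ *ᵥ w := by
    rw [← sub_pos, ← dotProduct_Qmat_mulVec, hw, mulVec_dotProduct_mulVec hB,
      dotProduct_Qmat_mulVec, ← hU]
    simp only [hUdot, hUU, dotProduct_smul, smul_dotProduct, smul_eq_mul]
    linarith
  have hww : 0 ≤ w ⬝ᵥ w := by
    simpa using dotProduct_self_star_nonneg w
  rw [dotProduct_Qmat_mulVec, Matrix.add_mulVec, Matrix.smul_mulVec, Matrix.smul_mulVec,
    Matrix.one_mulVec, ← Matrix.mulVec_mulVec, ← hU]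
  set u := Uᵀ *ᵥ w with hu
  have e1 : Uᵀ *ᵥ (t • w + (1 - t) • U *ᵥ u) = (2 - t) • u := by
    rw [Matrix.mulVec_add, Matrix.mulVec_smul, Matrix.mulVec_smul, hUU, ← hu, smul_smul, ← add_smul]
    ring_nf
  rw [e1]
  simp only [dotProduct_add, add_dotProduct, smul_dotProduct, dotProduct_smul, hUdot, hUU,
    dotProduct_comm w (U *ᵥ u), ← hu, smul_eq_mul]
  obtain ⟨h0, h1⟩ := ht
  rcases h1.eq_or_lt with rfl | h1
  · nlinarith
  · nlinarith [mul_nonneg (mul_nonneg h0 h0) (sub_nonneg.mpr hw0.le),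
      mul_pos (sub_pos.mpr h1) (hww.trans_lt hw0)]

lemma det_mul_det_mul_det_pos {A B : Matrix (Fin g × Fin 2) (Fin g × Fin 2) ℝ}
    (hA : Aᵀ * (Qmat g).map (Int.castRingHom ℝ) * A = (Qmat g).map (Int.castRingHom ℝ))
    (hB : Bᵀ * (Qmat g).map (Int.castRingHom ℝ) * B = (Qmat g).map (Int.castRingHom ℝ)) :
    0 < ((positiveBasis g ℝ)ᵀ * A * positiveBasis g ℝ).det *
      ((positiveBasis g ℝ)ᵀ * B * positiveBasis g ℝ).det *
      ((positiveBasis g ℝ)ᵀ * (A * B) * positiveBasis g ℝ).det := by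
  set U := positiveBasis g ℝ with hU
  set f : ℝ → ℝ := fun t => (Uᵀ * A * (t • 1 + (1 - t) • (U * Uᵀ)) * B * U).det with hf
  have hcont : Continuous f := by
    refine Continuous.matrix_det ?_
    fun_prop
  have hne : ∀ t ∈ Set.Icc (0 : ℝ) 1, f t ≠ 0 := fun t ht => det_positiveBasis_ne_zero hA hB ht
  have h0 : f 0 = (Uᵀ * A * U).det * (Uᵀ * B * U).det := by
    rw [← Matrix.det_mul, hf]
    simp [Matrix.mul_assoc]
  have h1 : f 1 = (Uᵀ * (A * B) * U).det := by
    rw [hf]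
    simp [Matrix.mul_assoc]
  rw [← h0, ← h1]
  by_contra! h
  have : (0 : ℝ) ∈ Set.uIcc (f 0) (f 1) := by
    rw [Set.mem_uIcc]
    rcases mul_nonpos_iff.mp h with h | h
    · exact Or.inr h.symm
    · exact Or.inl h
  obtain ⟨t, ht, hft⟩ := intermediate_value_uIcc hcont.continuousOn this
  rw [Set.uIcc_of_le zero_le_one] at ht
  exact hne t ht hft

/-- The action on the orientation of maximal positive definite subspaces. -/
noncomputable def positiveSign : orthogonalGroup g →* SignType where
  toFun M := SignType.sign ((positiveBasis g ℤ)ᵀ * mat M * positiveBasis g ℤ).det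
  map_one' := by
    rw [mat_one, Matrix.mul_one, positiveBasis_transpose_mul, sign_eq_one_iff,
      ← Nat.cast_ofNat (R := Matrix (Fin g) (Fin g) ℤ), ← Matrix.diagonal_natCast,
      Matrix.det_diagonal]
    simp
  map_mul' M N := by
    have hreal : ∀ M : orthogonalGroup g, ((mat M).map (Int.castRingHom ℝ))ᵀ *
        (Qmat g).map (Int.castRingHom ℝ) * (mat M).map (Int.castRingHom ℝ) =
        (Qmat g).map (Int.castRingHom ℝ) := fun M => by
      rw [← Matrix.transpose_map, ← Matrix.map_mul, ← Matrix.map_mul, mat_form]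
    have hbasis : (positiveBasis g ℤ).map (Int.castRingHom ℝ) = positiveBasis g ℝ := by
      ext p i
      simp [positiveBasis, apply_ite]
    have hdet : ∀ A : Matrix (Fin g × Fin 2) (Fin g × Fin 2) ℤ,
        ((positiveBasis g ℝ)ᵀ * A.map (Int.castRingHom ℝ) * positiveBasis g ℝ).det =
          (((positiveBasis g ℤ)ᵀ * A * positiveBasis g ℤ).det : ℝ) := fun A => by
      rw [← hbasis, ← Matrix.transpose_map, ← Matrix.map_mul, ← Matrix.map_mul]
      exact (RingHom.map_det (Int.castRingHom ℝ) _).symm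
    have h := det_mul_det_mul_det_pos (hreal M) (hreal N)
    rw [← Matrix.map_mul, hdet, hdet, hdet, ← mat_mul] at h
    norm_cast at h
    rw [← sign_mul]
    rcases mul_pos_iff.mp h with ⟨h1, h2⟩ | ⟨h1, h2⟩
    · rw [sign_pos h1, sign_pos h2]
    · rw [sign_neg h1, sign_neg h2]

lemma positiveSign_apply (M : orthogonalGroup g) :
    positiveSign M = SignType.sign ((positiveBasis g ℤ)ᵀ * mat M * positiveBasis g ℤ).det := rfl

end Sign

lemma sum_mat_mul_mat_of_mem_fixer {z : Fin g} {M : orthogonalGroup g}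
    (hM : M ∈ fixer (Prod.fst ⁻¹' {z}ᶜ)) (e f : Fin 2) :
    mat M (z, 1) (z, e) * mat M (z, 0) (z, f) + mat M (z, 0) (z, e) * mat M (z, 1) (z, f) =
      if e = f then 0 else 1 := by
  have h := sum_mat_mul_mat M (z, e) (z, f)
  rw [Fintype.sum_prod_type, Finset.sum_eq_single z] at h
  · rw [Fin.sum_univ_two] at h
    refine h.trans ?_
    fin_cases e <;> fin_cases f <;> simp [dual]
  · intro i _ hi
    refine Finset.sum_eq_zero fun a _ => ?_
    rw [fixer_row hM (p := (i, a)) (by simpa using hi), if_neg (fun e => hi (congrArg Prod.fst e)),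
      mul_zero]
  · simp

lemma positiveSign_of_mem_fixer {z : Fin g} {M : orthogonalGroup g}
    (hM : M ∈ fixer (Prod.fst ⁻¹' {z}ᶜ)) :
    positiveSign M = SignType.sign (mat M (z, 0) (z, 0) + mat M (z, 0) (z, 1) +
      mat M (z, 1) (z, 0) + mat M (z, 1) (z, 1)) := by
  have h : (positiveBasis g ℤ)ᵀ * mat M * positiveBasis g ℤ = Matrix.diagonal fun i =>
      if i = z then mat M (z, 0) (z, 0) + mat M (z, 0) (z, 1) +
        mat M (z, 1) (z, 0) + mat M (z, 1) (z, 1) else 2 := by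
    ext i j
    have hij : ((positiveBasis g ℤ)ᵀ * mat M * positiveBasis g ℤ) i j =
        mat M (i, 0) (j, 0) + mat M (i, 0) (j, 1) + mat M (i, 1) (j, 0) + mat M (i, 1) (j, 1) := by
      simp only [Matrix.mul_apply, Matrix.transpose_apply, positiveBasis, Matrix.of_apply,
        Fintype.sum_prod_type, Fin.sum_univ_two]
      simp [Finset.sum_add_distrib]
      ring
    rw [hij]
    by_cases hi : i = z
    · subst hi
      by_cases hj : j = i
      · subst hj
        simp
      · simp [mem_fixer_iff.mp hM (j, _) hj, Ne.symm hj]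
    · have := fun e => fixer_row hM (p := (i, e)) (by simpa using hi)
      by_cases hj : i = j
      · subst hj
        simp [this, hi]
      · simp [this, hj]
  rw [positiveSign_apply, h, Matrix.det_diagonal, ← Finset.mul_prod_erase _ _ (Finset.mem_univ z),
    sign_mul, if_pos rfl, sign_pos (a := ∏ i ∈ Finset.univ.erase z, _), mul_one]
  refine Finset.prod_pos fun i hi => ?_
  rw [if_neg (Finset.ne_of_mem_erase hi)]
  norm_num

/-- The determinant, as a homomorphism on `O_{g,g}(ℤ)`. -/
def detHom : orthogonalGroup g →* ℤˣ :=
  Matrix.GeneralLinearGroup.det.comp (orthogonalGroup g).subtype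

lemma coe_detHom (M : orthogonalGroup g) : (detHom M : ℤ) = (mat M).det := rfl

/-- Negation on the `z`-th hyperbolic plane. -/
def blockNeg (z : Fin g) : orthogonalGroup g :=
  ofMatrix (Matrix.diagonal fun p => if p.1 = z then -1 else 1) (by
    ext p q
    rw [Matrix.diagonal_transpose, Matrix.mul_diagonal, Matrix.diagonal_mul, Qmat_apply]
    split_ifs <;> simp_all)

lemma blockNeg_mem_fixer (z : Fin g) : blockNeg z ∈ fixer (Prod.fst ⁻¹' {z}ᶜ) := by
  rw [mem_fixer_iff]
  intro p hp r
  have hp : p.1 ≠ z := hp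
  by_cases h : r = p <;> simp [blockNeg, hp, h]

lemma positiveSign_blockNeg (z : Fin g) : positiveSign (blockNeg z) = -1 := by
  rw [positiveSign_of_mem_fixer (blockNeg_mem_fixer z), sign_eq_neg_one_iff]
  simp [blockNeg]

lemma detHom_blockNeg (z : Fin g) : detHom (blockNeg z) = 1 := by
  ext
  rw [coe_detHom, blockNeg, mat_ofMatrix, Matrix.det_diagonal, Fintype.prod_prod_type]
  exact Finset.prod_eq_one fun i _ => by by_cases h : i = z <;> simp [h]

/-- The reflection exchanging the two basis vectors of the `z`-th hyperbolic plane. -/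
def blockSwap (z : Fin g) : orthogonalGroup g :=
  ofMatrix ((Equiv.swap (z, 0) (z, 1)).permMatrix ℤ) (by
    have h : ∀ p, Equiv.swap (z, 0) (z, 1) (dual p) = dual (Equiv.swap (z, 0) (z, 1) p) := by
      rintro ⟨i, e⟩
      by_cases hi : i = z
      · subst hi
        fin_cases e <;> simp [dual]
      · simp [dual, Equiv.swap_apply_of_ne_of_ne, hi]
    rw [Matrix.transpose_permMatrix, Equiv.swap_inv]
    ext p q
    rw [PEquiv.toMatrix_toPEquiv_mul, PEquiv.mul_toMatrix_toPEquiv]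
    simp [Qmat_apply, ← h])

lemma mat_blockSwap (z : Fin g) :
    mat (blockSwap z) = (Equiv.swap (z, 0) (z, 1)).permMatrix ℤ := rfl

lemma blockSwap_mem_fixer (z : Fin g) : blockSwap z ∈ fixer (Prod.fst ⁻¹' {z}ᶜ) := by
  rw [mem_fixer_iff]
  rintro ⟨i, e⟩ hp r
  have hp : i ≠ z := hp
  rw [mat_blockSwap]
  simp [Equiv.Perm.permMatrix, PEquiv.toMatrix_apply, Equiv.swap_apply_eq_iff,
    Equiv.swap_apply_of_ne_of_ne, hp]

lemma positiveSign_blockSwap (z : Fin g) : positiveSign (blockSwap z) = 1 := by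
  rw [positiveSign_of_mem_fixer (blockSwap_mem_fixer z), sign_eq_one_iff]
  simp [mat_blockSwap, Equiv.Perm.permMatrix, PEquiv.toMatrix_apply]

lemma detHom_blockSwap (z : Fin g) : detHom (blockSwap z) = -1 := by
  ext
  rw [coe_detHom, mat_blockSwap, Matrix.det_permutation, Equiv.Perm.sign_swap (by simp)]
  simp

lemma fixer_ext {z : Fin g} {M N : orthogonalGroup g} (hM : M ∈ fixer (Prod.fst ⁻¹' {z}ᶜ))
    (hN : N ∈ fixer (Prod.fst ⁻¹' {z}ᶜ)) (h : ∀ e f, mat M (z, e) (z, f) = mat N (z, e) (z, f)) :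
    M = N := by
  apply mat_injective
  ext ⟨i, e⟩ ⟨j, f⟩
  by_cases hi : i = z
  · by_cases hj : j = z
    · rw [hi, hj, h]
    · rw [mem_fixer_iff.mp hM (j, f) hj, mem_fixer_iff.mp hN (j, f) hj]
  · rw [fixer_row hM (p := (i, e)) (by simpa using hi),
      fixer_row hN (p := (i, e)) (by simpa using hi)]

lemma eq_one_of_mem_fixer {z : Fin g} {M : orthogonalGroup g}
    (hM : M ∈ fixer (Prod.fst ⁻¹' {z}ᶜ)) (hdet : detHom M = 1) (hsign : positiveSign M = 1) :
    M = 1 := by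
  rw [positiveSign_of_mem_fixer hM, sign_eq_one_iff] at hsign
  have h00 := sum_mat_mul_mat_of_mem_fixer hM 0 0
  have h01 := sum_mat_mul_mat_of_mem_fixer hM 0 1
  have h11 := sum_mat_mul_mat_of_mem_fixer hM 1 1
  simp only [↓reduceIte, zero_ne_one] at h00 h01 h11
  have hunit : ∀ x y : ℤ, x * y = 1 → 0 < x + y → x = 1 ∧ y = 1 := by
    intro x y h h'
    rcases Int.mul_eq_one_iff_eq_one_or_neg_one.mp h with h | h <;> omega
  have hz : ∀ x y : ℤ, y * x + x * y = 0 → x = 0 ∨ y = 0 := fun x y h =>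
    mul_eq_zero.mp (by linarith)
  rcases hz _ _ h00 with h0 | h0
  · rw [h0] at h01 hsign
    obtain ⟨h1, h2⟩ := hunit _ _ (by linarith : mat M (z, 1) (z, 0) * mat M (z, 0) (z, 1) = 1) (by
      rcases hz _ _ h11 with h3 | h3
      · rw [h3] at h01
        omega
      · omega)
    have h3 : mat M (z, 1) (z, 1) = 0 := by rw [h2] at h11; omega
    have : M = blockSwap z := fixer_ext hM (blockSwap_mem_fixer z) fun e f => by
      fin_cases e <;> fin_cases f <;>
        simp [mat_blockSwap, Equiv.Perm.permMatrix, PEquiv.toMatrix_apply, h0, h1, h2, h3]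
    rw [this, detHom_blockSwap] at hdet
    exact absurd hdet (by decide)
  · rw [h0] at h01 hsign
    obtain ⟨h1, h2⟩ := hunit _ _ (by linarith : mat M (z, 0) (z, 0) * mat M (z, 1) (z, 1) = 1) (by
      rcases hz _ _ h11 with h3 | h3
      · omega
      · rw [h3] at h01
        omega)
    have h3 : mat M (z, 0) (z, 1) = 0 := by rw [h2] at h11; omega
    refine fixer_ext hM (one_mem _) fun e f => ?_
    fin_cases e <;> fin_cases f <;> simp [h0, h1, h2, h3]

variable (g) in
/-- The homomorphism to `(ℤ/2)²` which turns out to be the abelianisation of `O_{g,g}(ℤ)`. -/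
noncomputable def signs : orthogonalGroup g →* ℤˣ × SignTypeˣ :=
  detHom.prod positiveSign.toHomUnits

lemma signs_surjective (z : Fin g) : Function.Surjective (signs g) := by
  have h1 : signs g (blockNeg z) = (1, -1) :=
    Prod.ext (detHom_blockNeg z) (Units.ext (positiveSign_blockNeg z))
  have h2 : signs g (blockSwap z) = (-1, 1) :=
    Prod.ext (detHom_blockSwap z) (Units.ext (positiveSign_blockSwap z))
  have h : ∀ v : SignTypeˣ, v = 1 ∨ v = -1 := by decide
  rintro ⟨u, v⟩
  rcases Int.units_eq_one_or u with rfl | rfl <;> rcases h v with rfl | rfl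
  · exact ⟨1, map_one _⟩
  · exact ⟨_, h1⟩
  · exact ⟨_, h2⟩
  · exact ⟨blockNeg z * blockSwap z, by simp [h1, h2]⟩

lemma ker_signs_le (hg : 3 ≤ g) : (signs g).ker ≤ commutator (orthogonalGroup g) := by
  intro M hM
  have z : Fin g := ⟨0, by omega⟩
  obtain ⟨N, hN, h⟩ := exists_commutator_mul_mem_fixer hg z M (Finset.univ.erase z) (by simp)
  have hset : ((Finset.univ.erase z : Finset (Fin g)) : Set (Fin g)) = {z}ᶜ := by
    ext
    simp
  rw [hset] at h
  have hNM : signs g (N * M) = 1 := by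
    rw [map_mul, MonoidHom.mem_ker.mp hM, Abelianization.commutator_subset_ker (signs g) hN,
      mul_one]
  have := eq_one_of_mem_fixer h (congrArg Prod.fst hNM)
    (congrArg (fun x : ℤˣ × SignTypeˣ => (x.2 : SignType)) hNM)
  rw [eq_inv_of_mul_eq_one_right this]
  exact inv_mem hN

end HyperbolicOrthogonal

open HyperbolicOrthogonal in
/-- For `g ≥ 3`, the abelianisation of `O_{g,g}(ℤ)` (the subgroup of `GL_{2g}(ℤ)` of matrices
`M` with `MᵀQM = Q`) is isomorphic to `(ℤ/2) × (ℤ/2)`. -/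
theorem abelianization_Ogg (g : ℕ) (hg : 3 ≤ g)
    (H : Subgroup (Matrix.GeneralLinearGroup (Fin g × Fin 2) ℤ))
    (hH : ∀ M : Matrix.GeneralLinearGroup (Fin g × Fin 2) ℤ,
      M ∈ H ↔ (M : Matrix (Fin g × Fin 2) (Fin g × Fin 2) ℤ)ᵀ * Qmat g
        * (M : Matrix (Fin g × Fin 2) (Fin g × Fin 2) ℤ) = Qmat g) :
    Nonempty (Abelianization H ≃* Multiplicative (ZMod 2 × ZMod 2)) := by
  obtain rfl : H = orthogonalGroup g := Subgroup.ext hH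
  have hbij : Function.Bijective (Abelianization.lift (signs g)) := by
    constructor
    · rw [injective_iff_map_eq_one]
      intro x hx
      obtain ⟨M, rfl⟩ := QuotientGroup.mk_surjective x
      exact (QuotientGroup.eq_one_iff M).mpr (ker_signs_le hg hx)
    · intro y
      obtain ⟨M, hM⟩ := signs_surjective (⟨0, by omega⟩ : Fin g) y
      exact ⟨Abelianization.of M, hM⟩
  have hcard : Nat.card (Multiplicative (ZMod 2)) = 2 := by simp
  have e₁ : ℤˣ ≃* Multiplicative (ZMod 2) :=
    mulEquivOfPrimeCardEq (p := 2) (by rw [Nat.card_eq_fintype_card]; decide) hcard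
  have e₂ : SignTypeˣ ≃* Multiplicative (ZMod 2) :=
    mulEquivOfPrimeCardEq (p := 2) (by rw [Nat.card_eq_fintype_card]; decide) hcard
  exact ⟨(MulEquiv.ofBijective _ hbij).trans
    ((e₁.prodCongr e₂).trans (MulEquiv.prodMultiplicative _ _).symm)⟩
end

section
/- The abelianisation of the group O_{2,2}(ℤ) is isomorphic to (ℤ/2) × (ℤ/2) × (ℤ/2). (Equivalently, H₁(O_{2,2}(ℤ); ℤ) ≅ (ℤ/2)³.) -/
open Matrix

/-- The Gram matrix `Qmat 2` reindexed by `Fin 4`. -/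
def hypGram : Matrix (Fin 4) (Fin 4) ℤ :=
  !![0, 1, 0, 0; 1, 0, 0, 0; 0, 0, 0, 1; 0, 0, 1, 0]

/-- The integral orthogonal group of the form `hypGram`. -/
def hypOrthogonal : Subgroup (GL (Fin 4) ℤ) where
  carrier := {M | M.1ᵀ * hypGram * M.1 = hypGram}
  one_mem' := by simp
  mul_mem' {M N} hM hN := by
    simp only [Set.mem_ofPred_eq, Units.val_mul, transpose_mul] at *
    calc _ = N.1ᵀ * (M.1ᵀ * hypGram * M.1) * N.1 := by simp only [Matrix.mul_assoc]
      _ = _ := by rw [hM, hN]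
  inv_mem' {M} hM := by
    simp only [Set.mem_ofPred_eq] at *
    have h : M.1 * (M⁻¹).1 = 1 := by simp
    have h' : (M⁻¹).1ᵀ * M.1ᵀ = 1 := by rw [← transpose_mul, h, transpose_one]
    calc _ = (M⁻¹).1ᵀ * (M.1ᵀ * hypGram * M.1) * (M⁻¹).1 := by rw [hM]
      _ = ((M⁻¹).1ᵀ * M.1ᵀ) * hypGram * (M.1 * (M⁻¹).1) := by simp only [Matrix.mul_assoc]
      _ = _ := by rw [h, h']; simp

namespace hypOrthogonal

theorem hypGram_mul_self : hypGram * hypGram = 1 := by decide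

/-- A matrix preserving `hypGram`, as an element of the orthogonal group. -/
def ofMatrix (N : Matrix (Fin 4) (Fin 4) ℤ) (h : Nᵀ * hypGram * N = hypGram) : hypOrthogonal :=
  have h' : hypGram * Nᵀ * hypGram * N = 1 := by
    rw [Matrix.mul_assoc hypGram, Matrix.mul_assoc hypGram, h, hypGram_mul_self]
  ⟨⟨N, hypGram * Nᵀ * hypGram, mul_eq_one_comm.mp h', h'⟩, h⟩

@[simp]
theorem ofMatrix_val (N : Matrix (Fin 4) (Fin 4) ℤ) (h : Nᵀ * hypGram * N = hypGram) :
    (ofMatrix N h).1.1 = N := rfl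

theorem ext_val {M N : hypOrthogonal} (h : M.1.1 = N.1.1) : M = N :=
  Subtype.ext (Units.ext h)

theorem gram_entries (M : hypOrthogonal) (i j : Fin 4) :
    M.1.1 0 i * M.1.1 1 j + M.1.1 1 i * M.1.1 0 j + M.1.1 2 i * M.1.1 3 j
      + M.1.1 3 i * M.1.1 2 j = hypGram i j := by
  have h : M.1.1ᵀ * hypGram * M.1.1 = hypGram := M.2
  rw [← congrFun (congrFun h i) j]
  simp [Matrix.mul_apply, Fin.sum_univ_four, hypGram]
  ring

/-- Left multiplication by a `2 × 2` matrix on `2 × 2` matrices `[[x₀, -x₂], [x₃, x₁]]`, whose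
determinant is the quadratic form of `hypGram`. -/
def leftMulMatrix (A : Matrix (Fin 2) (Fin 2) ℤ) : Matrix (Fin 4) (Fin 4) ℤ :=
  !![A 0 0, 0, 0, A 0 1; 0, A 1 1, -A 1 0, 0; 0, -A 0 1, A 0 0, 0; A 1 0, 0, 0, A 1 1]

theorem leftMulMatrix_one : leftMulMatrix 1 = 1 := by decide

theorem leftMulMatrix_mul (A B : Matrix (Fin 2) (Fin 2) ℤ) :
    leftMulMatrix (A * B) = leftMulMatrix A * leftMulMatrix B := by
  ext i j
  fin_cases i <;> fin_cases j <;>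
    simp [leftMulMatrix, Matrix.mul_apply, Fin.sum_univ_four] <;> ring

theorem leftMulMatrix_gram (A : Matrix (Fin 2) (Fin 2) ℤ) :
    (leftMulMatrix A)ᵀ * hypGram * leftMulMatrix A = A.det • hypGram := by
  ext i j
  fin_cases i <;> fin_cases j <;>
    simp [leftMulMatrix, Matrix.mul_apply, Fin.sum_univ_four, hypGram, det_fin_two] <;> ring

/-- The action of `SL(2, ℤ)` through `leftMulMatrix`. -/
def leftMul : SpecialLinearGroup (Fin 2) ℤ →* hypOrthogonal where
  toFun A := ofMatrix (leftMulMatrix A.1) (by rw [leftMulMatrix_gram, A.2, one_smul])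
  map_one' := ext_val leftMulMatrix_one
  map_mul' A B := ext_val (leftMulMatrix_mul A.1 B.1)

theorem leftMul_val (A : SpecialLinearGroup (Fin 2) ℤ) :
    (leftMul A).1.1 = !![A 0 0, 0, 0, A 0 1; 0, A 1 1, -A 1 0, 0;
      0, -A 0 1, A 0 0, 0; A 1 0, 0, 0, A 1 1] := rfl

/-- The reflection exchanging the last two basis vectors. -/
def swapLast : hypOrthogonal :=
  ofMatrix !![1, 0, 0, 0; 0, 1, 0, 0; 0, 0, 0, 1; 0, 0, 1, 0] (by decide)

/-- The negation of the last two basis vectors. -/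
def negLast : hypOrthogonal :=
  ofMatrix !![1, 0, 0, 0; 0, 1, 0, 0; 0, 0, -1, 0; 0, 0, 0, -1] (by decide)

theorem swapLast_mul_self : swapLast * swapLast = 1 := ext_val (by decide)

theorem negLast_mul_self : negLast * negLast = 1 := ext_val (by decide)

/-! ### Generation -/

theorem exists_SL2_annihilate (a c : ℤ) :
    ∃ A : SpecialLinearGroup (Fin 2) ℤ, A 1 0 * a + A 1 1 * c = 0 := by
  by_cases h : 0 < Int.gcd a c
  · obtain ⟨a', c', hco, ha, hc⟩ := Int.exists_gcd_one h
    have hco' : IsCoprime (-c') a' := (Int.isCoprime_iff_gcd_eq_one.mpr hco).symm.neg_left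
    obtain ⟨A, h0, h1⟩ := hco'.exists_SL2_row 1
    refine ⟨A, ?_⟩
    rw [h0, h1]
    linear_combination (-c') * ha + a' * hc
  · obtain ⟨rfl, rfl⟩ := Int.gcd_eq_zero_iff.mp (Nat.eq_zero_of_not_pos h)
    exact ⟨1, by simp⟩

theorem leftMul_mulVec (A : SpecialLinearGroup (Fin 2) ℤ) (v : Fin 4 → ℤ) :
    (leftMul A).1.1 *ᵥ v = ![A 0 0 * v 0 + A 0 1 * v 3, A 1 1 * v 1 - A 1 0 * v 2,
      -A 0 1 * v 1 + A 0 0 * v 2, A 1 0 * v 0 + A 1 1 * v 3] := by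
  ext i
  fin_cases i <;> simp [leftMul_val, Matrix.mulVec, dotProduct, Fin.sum_univ_four]
  ring

theorem rightMul_mulVec (A : SpecialLinearGroup (Fin 2) ℤ) (v : Fin 4 → ℤ) :
    (swapLast * leftMul A * swapLast).1.1 *ᵥ v =
      ![A 0 0 * v 0 + A 0 1 * v 2, A 1 1 * v 1 - A 1 0 * v 3,
        A 1 0 * v 0 + A 1 1 * v 2, -A 0 1 * v 1 + A 0 0 * v 3] := by
  have hs (w : Fin 4 → ℤ) : swapLast.1.1 *ᵥ w = ![w 0, w 1, w 3, w 2] := by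
    ext i
    fin_cases i <;> simp [swapLast, Matrix.mulVec, dotProduct, Fin.sum_univ_four]
  simp only [Subgroup.coe_mul, Units.val_mul, ← Matrix.mulVec_mulVec, hs, leftMul_mulVec]
  ext i
  fin_cases i <;> simp

section Generation

variable {K : Subgroup hypOrthogonal}

theorem exists_mulVec_eq_first (hL : ∀ A, leftMul A ∈ K) (hs : swapLast ∈ K)
    (v : Fin 4 → ℤ) (hv : v 0 * v 1 + v 2 * v 3 = 0) :
    ∃ k ∈ K, ∃ h : ℤ, k.1.1 *ᵥ v = ![h, 0, 0, 0] := by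
  have hR (A) : swapLast * leftMul A * swapLast ∈ K := K.mul_mem (K.mul_mem hs (hL A)) hs
  have clear2 (a c : ℤ) : ∃ k ∈ K, ∃ h : ℤ, k.1.1 *ᵥ ![a, 0, c, 0] = ![h, 0, 0, 0] := by
    obtain ⟨A, hA⟩ := exists_SL2_annihilate a c
    refine ⟨_, hR A, A 0 0 * a + A 0 1 * c, ?_⟩
    rw [rightMul_mulVec]
    simp [hA]
  have clear1 (a c : ℤ) : ∃ k ∈ K, ∃ h : ℤ, k.1.1 *ᵥ ![0, a, c, 0] = ![h, 0, 0, 0] := by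
    obtain ⟨A, hA⟩ := exists_SL2_annihilate (-c) a
    obtain ⟨k, hk, h, hkh⟩ := clear2 0 (-A 0 1 * a + A 0 0 * c)
    refine ⟨_, K.mul_mem hk (hL A), h, ?_⟩
    rw [Subgroup.coe_mul, Units.val_mul, ← Matrix.mulVec_mulVec, leftMul_mulVec, ← hkh]
    congr 1
    simp
    linarith
  obtain ⟨A, hA⟩ := exists_SL2_annihilate (v 0) (v 3)
  set w : Fin 4 → ℤ := (leftMul A).1.1 *ᵥ v with hw
  rw [leftMul_mulVec, hA] at hw
  have hprod : (A 0 0 * v 0 + A 0 1 * v 3) * (A 1 1 * v 1 - A 1 0 * v 2) = 0 := by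
    linear_combination
      (-(-A 0 1 * v 1 + A 0 0 * v 2)) * hA + (A 0 0 * A 1 1 - A 0 1 * A 1 0) * hv
  suffices ∃ k ∈ K, ∃ h : ℤ, k.1.1 *ᵥ w = ![h, 0, 0, 0] by
    obtain ⟨k, hk, h, hkh⟩ := this
    refine ⟨_, K.mul_mem hk (hL A), h, ?_⟩
    rw [Subgroup.coe_mul, Units.val_mul, ← Matrix.mulVec_mulVec]
    exact hkh
  rcases mul_eq_zero.mp hprod with h | h
  · rw [hw, h]
    exact clear1 _ _
  · rw [hw, h]
    exact clear2 _ _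

theorem mem_of_fixes (hs : swapLast ∈ K) (hd : negLast ∈ K) (M : hypOrthogonal)
    (h0 : ∀ i, M.1.1 i 0 = ![1, 0, 0, 0] i) (h1 : ∀ i, M.1.1 i 1 = ![0, 1, 0, 0] i) : M ∈ K := by
  have e02 := gram_entries M 0 2
  have e03 := gram_entries M 0 3
  have e12 := gram_entries M 1 2
  have e13 := gram_entries M 1 3
  have e22 := gram_entries M 2 2
  have e33 := gram_entries M 3 3
  have e23 := gram_entries M 2 3
  simp only [h0, h1, hypGram] at e02 e03 e12 e13 e22 e33 e23
  simp at e02 e03 e12 e13 e22 e33 e23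
  simp only [e02, e03, zero_mul, mul_zero, zero_add, add_zero] at e22 e33 e23
  have key (p q r s : ℤ) (hp : M.1.1 2 2 = p) (hq : M.1.1 3 2 = q) (hr : M.1.1 2 3 = r)
      (hs : M.1.1 3 3 = s) :
      M.1.1 = !![1, 0, 0, 0; 0, 1, 0, 0; 0, 0, p, r; 0, 0, q, s] := by
    ext i j
    fin_cases i <;> fin_cases j <;> simp [h0, h1, e02, e03, e12, e13, hp, hq, hr, hs]
  have hpq : M.1.1 2 2 = 0 ∨ M.1.1 3 2 = 0 := by
    rw [← mul_eq_zero]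
    linarith
  rcases hpq with h | h
  · rw [h, zero_mul, zero_add] at e23
    have hss : M.1.1 3 3 = 0 := by
      have : M.1.1 2 3 ≠ 0 := by rintro h'; simp [h'] at e23
      have h2 : M.1.1 2 3 * M.1.1 3 3 = 0 := by linarith
      exact (mul_eq_zero.mp h2).resolve_left this
    rcases Int.mul_eq_one_iff_eq_one_or_neg_one.mp e23 with ⟨h2, h3⟩ | ⟨h2, h3⟩
    · convert hs
      exact ext_val (key _ _ _ _ h h2 h3 hss)
    · convert K.mul_mem hs hd
      refine ext_val ((key _ _ _ _ h h2 h3 hss).trans ?_)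
      decide
  · rw [h, zero_mul, add_zero] at e23
    have hrr : M.1.1 2 3 = 0 := by
      have : M.1.1 3 3 ≠ 0 := by rintro h'; simp [h'] at e23
      have h2 : M.1.1 2 3 * M.1.1 3 3 = 0 := by linarith
      exact (mul_eq_zero.mp h2).resolve_right this
    rcases Int.mul_eq_one_iff_eq_one_or_neg_one.mp e23 with ⟨h2, h3⟩ | ⟨h2, h3⟩
    · convert K.one_mem
      refine ext_val ((key _ _ _ _ h2 h hrr h3).trans ?_)
      decide
    · convert hd
      exact ext_val (key _ _ _ _ h2 h hrr h3)

theorem mem_of_fixes_first (hL : ∀ A, leftMul A ∈ K) (hs : swapLast ∈ K) (hd : negLast ∈ K)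
    (M : hypOrthogonal) (h0 : M.1.1 *ᵥ Pi.single 0 1 = ![1, 0, 0, 0]) : M ∈ K := by
  have hR (A) : swapLast * leftMul A * swapLast ∈ K := K.mul_mem (K.mul_mem hs (hL A)) hs
  let U (b : ℤ) : SpecialLinearGroup (Fin 2) ℤ := ⟨!![1, b; 0, 1], by simp [det_fin_two]⟩
  set k := leftMul (U (M.1.1 2 1)) * (swapLast * leftMul (U (M.1.1 3 1)) * swapLast) with hk
  have hkK : k ∈ K := K.mul_mem (hL _) (hR _)
  have h0' (i : Fin 4) : M.1.1 i 0 = ![1, 0, 0, 0] i := by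
    rw [← h0, Matrix.mulVec_single_one]
    rfl
  have e01 := gram_entries M 0 1
  have e11 := gram_entries M 1 1
  simp [h0', hypGram] at e01 e11
  refine (K.mul_mem_cancel_left hkK).mp (mem_of_fixes hs hd (k * M) (fun i => ?_) fun i => ?_)
  · have : (k * M).1.1 *ᵥ Pi.single 0 1 = ![1, 0, 0, 0] := by
      rw [Subgroup.coe_mul, Units.val_mul, ← Matrix.mulVec_mulVec, h0, hk, Subgroup.coe_mul,
        Units.val_mul, ← Matrix.mulVec_mulVec, rightMul_mulVec, leftMul_mulVec]
      simp [U]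
    rw [← this, Matrix.mulVec_single_one]
    rfl
  · have : (k * M).1.1 *ᵥ Pi.single 1 1 = ![0, 1, 0, 0] := by
      rw [Subgroup.coe_mul, Units.val_mul, ← Matrix.mulVec_mulVec, hk, Subgroup.coe_mul,
        Units.val_mul, ← Matrix.mulVec_mulVec, rightMul_mulVec, leftMul_mulVec]
      simp [U, e01] at e11 ⊢
      linarith
    rw [← this, Matrix.mulVec_single_one]
    rfl

theorem eq_top_of_mem (hL : ∀ A, leftMul A ∈ K) (hs : swapLast ∈ K) (hd : negLast ∈ K)
    (M : hypOrthogonal) : M ∈ K := by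
  have e00 := gram_entries M 0 0
  simp [hypGram] at e00
  obtain ⟨k, hk, h, hkh⟩ := exists_mulVec_eq_first hL hs (M.1.1 *ᵥ Pi.single 0 1) (by
    simp
    linarith)
  rw [Matrix.mulVec_mulVec, ← Units.val_mul, ← Subgroup.coe_mul] at hkh
  have hcol (i : Fin 4) : (k * M).1.1 i 0 = ![h, 0, 0, 0] i := by
    rw [← hkh, Matrix.mulVec_single_one]
    rfl
  have e01 := gram_entries (k * M) 0 1
  simp only [hcol, hypGram] at e01
  simp at e01
  rw [← K.mul_mem_cancel_left hk]
  rcases Int.mul_eq_one_iff_eq_one_or_neg_one.mp e01 with ⟨rfl, -⟩ | ⟨rfl, -⟩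
  · exact mem_of_fixes_first hL hs hd _ hkh
  · rw [← K.mul_mem_cancel_left (hL (-1))]
    refine mem_of_fixes_first hL hs hd _ ?_
    rw [Subgroup.coe_mul, Units.val_mul, ← Matrix.mulVec_mulVec, hkh, leftMul_mulVec]
    simp

end Generation

/-! ### Quadratic characters from reductions modulo `n` -/

/-- The quadratic form whose polarization is `hypGram`. -/
def quad {R : Type*} [CommRing R] (v : Fin 4 → R) : R := v 0 * v 1 + v 2 * v 3

theorem quad_mulVec (M : hypOrthogonal) (v : Fin 4 → ℤ) : quad (M.1.1 *ᵥ v) = quad v := by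
  have h : M.1.1ᵀ * hypGram * M.1.1 = hypGram := M.2
  have two_quad (w : Fin 4 → ℤ) : w ⬝ᵥ hypGram *ᵥ w = 2 * quad w := by
    simp [dotProduct, Matrix.mulVec, Fin.sum_univ_four, hypGram, quad]
    ring
  have key : 2 * quad (M.1.1 *ᵥ v) = 2 * quad v := by
    rw [← two_quad, ← two_quad]
    conv_rhs => rw [← h]
    rw [← Matrix.mulVec_mulVec, ← Matrix.mulVec_mulVec, Matrix.dotProduct_mulVec v,
      Matrix.vecMul_transpose]
  linarith

/-- Reduction modulo `n`. -/
def redMod (n : ℕ) : hypOrthogonal →* Matrix (Fin 4) (Fin 4) (ZMod n) :=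
  (Int.castRingHom (ZMod n)).mapMatrix.toMonoidHom.comp
    ((Units.coeHom _).comp hypOrthogonal.subtype)

theorem quad_redMod_mulVec (n : ℕ) (M : hypOrthogonal) (v : Fin 4 → ZMod n) :
    quad (redMod n M *ᵥ v) = quad v := by
  have hcast (u : Fin 4 → ℤ) : quad (fun i => (u i : ZMod n)) = (quad u : ℤ) := by simp [quad]
  obtain ⟨w, rfl⟩ : ∃ w : Fin 4 → ℤ, v = fun i => (w i : ZMod n) :=
    ⟨fun i => (ZMod.intCast_surjective (v i)).choose,
      funext fun i => (ZMod.intCast_surjective (v i)).choose_spec.symm⟩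
  have h : redMod n M *ᵥ (fun i => (w i : ZMod n)) = fun i => ((M.1.1 *ᵥ w) i : ZMod n) :=
    funext fun i => ((Int.castRingHom (ZMod n)).map_mulVec M.1.1 w i).symm
  rw [h, hcast, quad_mulVec, hcast]

/-- The vectors of norm `c` modulo `n`. -/
abbrev Level (n : ℕ) (c : ZMod n) : Type := {v : Fin 4 → ZMod n // quad v = c}

/-- The permutation action on the vectors of norm `c` modulo `n`. -/
def levelPerm (n : ℕ) (c : ZMod n) : hypOrthogonal →* Equiv.Perm (Level n c) :=
  MonoidHom.toHomPerm
    { toFun := fun M v => ⟨redMod n M *ᵥ v.1, (quad_redMod_mulVec n M v.1).trans v.2⟩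
      map_one' := by
        funext v
        simp
        rfl
      map_mul' := fun M N => by
        funext v
        simp [← Matrix.mulVec_mulVec]
        rfl }

theorem levelPerm_apply (n : ℕ) (c : ZMod n) (M : hypOrthogonal) (v : Level n c) :
    (levelPerm n c M v).1 = redMod n M *ᵥ v.1 := rfl

/-- The sign of the permutation action on the vectors of norm `c` modulo `n`. -/
def levelSign (n : ℕ) [NeZero n] (c : ZMod n) : hypOrthogonal →* ℤˣ :=
  Equiv.Perm.sign.comp (levelPerm n c)

theorem _root_.Equiv.Perm.sign_eq_of_mul_self {α : Type*} [Fintype α] [DecidableEq α]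
    (σ : Equiv.Perm α) (h : σ * σ = 1) (k : ℕ) (hk : σ.support.card = 2 * k) :
    Equiv.Perm.sign σ = (-1) ^ k := by
  have hc : σ.cycleType = Multiset.replicate k 2 := by
    have h2 : ∀ m ∈ σ.cycleType, m = 2 := fun m hm => by
      have h1 := Equiv.Perm.two_le_of_mem_cycleType hm
      have h3 := (Equiv.Perm.dvd_of_mem_cycleType hm).trans
        (orderOf_dvd_of_pow_eq_one (n := 2) (by rw [pow_two, h]))
      exact le_antisymm (Nat.le_of_dvd two_pos h3) h1
    have h4 := Multiset.eq_replicate_card.mpr h2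
    have h5 := σ.sum_cycleType
    rw [h4, Multiset.sum_replicate, hk, smul_eq_mul] at h5
    rw [h4]
    congr 1
    omega
  rw [Equiv.Perm.sign_of_cycleType, hc]
  simp [pow_add, pow_mul']

theorem levelSign_eq {n : ℕ} [NeZero n] (c : ZMod n) (M : hypOrthogonal)
    (hM : redMod n (M * M) = 1) (k : ℕ)
    (hk : (Finset.univ.filter fun v : Level n c => redMod n M *ᵥ v.1 ≠ v.1).card = 2 * k) :
    levelSign n c M = (-1) ^ k := by
  refine Equiv.Perm.sign_eq_of_mul_self _ ?_ k ?_
  · rw [← map_mul]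
    ext1 v
    apply Subtype.ext
    rw [levelPerm_apply, hM]
    simp
  · rw [← hk]
    congr 1
    ext v
    simp [Subtype.ext_iff, levelPerm_apply]

/-- Left multiplication by an elementary matrix. -/
def transvection : hypOrthogonal := leftMul ModularGroup.T

theorem levelSign_two_swapLast : levelSign 2 1 swapLast = -1 :=
  levelSign_eq 1 _ (by decide +kernel) 1 (by decide +kernel)

theorem levelSign_two_negLast : levelSign 2 1 negLast = 1 :=
  levelSign_eq 1 _ (by decide +kernel) 0 (by decide +kernel)

theorem levelSign_two_transvection : levelSign 2 1 transvection = -1 :=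
  levelSign_eq 1 _ (by decide +kernel) 3 (by decide +kernel)

theorem levelSign_three_swapLast : levelSign 3 1 swapLast = 1 :=
  levelSign_eq 1 _ (by decide +kernel) 6 (by decide +kernel)

theorem levelSign_three_negLast : levelSign 3 1 negLast = -1 :=
  levelSign_eq 1 _ (by decide +kernel) 11 (by decide +kernel)

theorem levelSign_three_transvection : levelSign 3 1 transvection = 1 := by
  have h : levelPerm 3 1 transvection ^ 3 = 1 := by
    rw [← map_pow]
    ext1 v
    apply Subtype.ext
    have h' : redMod 3 (transvection ^ 3) = 1 := by decide +kernel
    rw [levelPerm_apply, h']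
    simp
  have h1 : levelSign 3 1 transvection ^ 3 = 1 := by
    rw [levelSign, MonoidHom.comp_apply, ← map_pow, h, map_one]
  rcases Int.units_eq_one_or (levelSign 3 1 transvection) with h2 | h2
  · exact h2
  · rw [h2] at h1
    exact absurd h1 (by decide)

theorem det_transvection : GeneralLinearGroup.det transvection.1 = 1 := by decide +kernel

theorem det_swapLast : GeneralLinearGroup.det swapLast.1 = -1 := by decide +kernel

theorem det_negLast : GeneralLinearGroup.det negLast.1 = 1 := by decide +kernel

/-! ### The abelianization -/

/-- The determinant and the signs of the actions on the vectors of norm `1` modulo `2` and `3`. -/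
def characters : hypOrthogonal →* ℤˣ × ℤˣ × ℤˣ :=
  ((GeneralLinearGroup.det : GL (Fin 4) ℤ →* ℤˣ).comp hypOrthogonal.subtype).prod
    ((levelSign 2 1).prod (levelSign 3 1))

theorem characters_transvection : characters transvection = (1, -1, 1) :=
  Prod.ext det_transvection (Prod.ext levelSign_two_transvection levelSign_three_transvection)

theorem characters_swapLast : characters swapLast = (-1, -1, 1) :=
  Prod.ext det_swapLast (Prod.ext levelSign_two_swapLast levelSign_three_swapLast)

theorem characters_negLast : characters negLast = (1, 1, -1) :=
  Prod.ext det_negLast (Prod.ext levelSign_two_negLast levelSign_three_negLast)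

theorem negLast_conj_transvection : negLast * transvection * negLast = transvection⁻¹ := by
  rw [eq_inv_iff_mul_eq_one]
  exact ext_val (by decide +kernel)

theorem of_transvection_mul_self :
    Abelianization.of transvection * Abelianization.of transvection = 1 := by
  have h := congrArg Abelianization.of negLast_conj_transvection
  rw [map_mul, map_mul, map_inv, mul_right_comm, ← map_mul, negLast_mul_self, map_one, one_mul] at h
  nth_rewrite 1 [h]
  simp

theorem of_leftMul_S :
    Abelianization.of (leftMul ModularGroup.S) = (Abelianization.of transvection) ^ (-3 : ℤ) := by
  have h : (ModularGroup.S * ModularGroup.T) ^ 3 = ModularGroup.S ^ 2 := by decide +kernel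
  have h' := congrArg (Abelianization.of ∘ leftMul) h
  simp only [Function.comp_apply, map_pow, map_mul, mul_pow] at h'
  rw [_root_.zpow_neg, eq_inv_iff_mul_eq_one,
    ← mul_left_cancel_iff (a := Abelianization.of (leftMul ModularGroup.S) ^ 2), mul_one,
    ← mul_assoc, ← pow_succ]
  exact_mod_cast h'

theorem exists_of_eq (M : hypOrthogonal) : ∃ a b c : ℤ, Abelianization.of M =
    Abelianization.of transvection ^ a * Abelianization.of swapLast ^ b
      * Abelianization.of negLast ^ c := by
  let K : Subgroup hypOrthogonal :=
    { carrier := {M | ∃ a b c : ℤ, Abelianization.of M = Abelianization.of transvection ^ a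
        * Abelianization.of swapLast ^ b * Abelianization.of negLast ^ c}
      one_mem' := ⟨0, 0, 0, by simp⟩
      mul_mem' := by
        rintro M N ⟨a, b, c, h⟩ ⟨a', b', c', h'⟩
        refine ⟨a + a', b + b', c + c', ?_⟩
        simp only [map_mul, h, h', _root_.zpow_add]
        simp only [mul_assoc, mul_left_comm, mul_comm]
      inv_mem' := by
        rintro M ⟨a, b, c, h⟩
        refine ⟨-a, -b, -c, ?_⟩
        simp only [map_inv, h, _root_.zpow_neg, mul_inv] }
  have hL : ∀ A, leftMul A ∈ K := by
    have : Subgroup.closure {ModularGroup.S, ModularGroup.T} ≤ K.comap leftMul := by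
      rw [Subgroup.closure_le]
      rintro _ (rfl | rfl)
      · exact ⟨-3, 0, 0, by simp [of_leftMul_S]⟩
      · exact ⟨1, 0, 0, by simp [transvection]⟩
    rw [SpecialLinearGroup.SL2Z_generators] at this
    exact fun A => this (Subgroup.mem_top A)
  exact eq_top_of_mem hL ⟨0, 1, 0, by simp⟩ ⟨0, 0, 1, by simp⟩ M

theorem zpow_eq_one_or {G : Type*} [Group G] {x : G} (h : x * x = 1) (a : ℤ) :
    x ^ a = 1 ∨ x ^ a = x := by
  rcases Int.even_or_odd' a with ⟨k, rfl | rfl⟩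
  · left
    rw [_root_.zpow_mul, zpow_two, h, _root_.one_zpow]
  · right
    rw [_root_.zpow_add, _root_.zpow_mul, zpow_two, h, _root_.one_zpow, one_mul, zpow_one]

theorem lift_characters_bijective : Function.Bijective (Abelianization.lift characters) := by
  have hT := of_transvection_mul_self
  have hs : Abelianization.of swapLast * Abelianization.of swapLast = 1 := by
    rw [← map_mul, swapLast_mul_self, map_one]
  have hd : Abelianization.of negLast * Abelianization.of negLast = 1 := by
    rw [← map_mul, negLast_mul_self, map_one]
  constructor
  · rw [injective_iff_map_eq_one]
    intro x hx
    obtain ⟨M, rfl⟩ := QuotientGroup.mk_surjective x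
    change Abelianization.lift characters (Abelianization.of M) = 1 at hx
    change Abelianization.of M = 1
    obtain ⟨a, b, c, h⟩ := exists_of_eq M
    rw [h] at hx ⊢
    rcases zpow_eq_one_or hT a with ha | ha <;> rcases zpow_eq_one_or hs b with hb | hb <;>
      rcases zpow_eq_one_or hd c with hc | hc <;> rw [ha, hb, hc] at hx ⊢
    · simp
    all_goals
      simp only [map_mul, map_one, Abelianization.lift_apply_of, characters_transvection,
        characters_swapLast, characters_negLast] at hx
      exact absurd hx (by decide)
  · intro y
    have hy : ∃ a b c : Fin 2, y = (1, -1, 1) ^ a.1 * (-1, -1, 1) ^ b.1 * (1, 1, -1) ^ c.1 := by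
      revert y
      decide
    obtain ⟨a, b, c, rfl⟩ := hy
    refine ⟨Abelianization.of (transvection ^ a.1 * swapLast ^ b.1 * negLast ^ c.1), ?_⟩
    simp only [Abelianization.lift_apply_of, map_mul, map_pow, characters_transvection,
      characters_swapLast, characters_negLast]

end hypOrthogonal

theorem nonempty_intUnits_mulEquiv :
    Nonempty (ℤˣ × ℤˣ × ℤˣ ≃* Multiplicative (ZMod 2 × ZMod 2 × ZMod 2)) := by
  let f : Multiplicative (ZMod 2 × ZMod 2 × ZMod 2) →* ℤˣ × ℤˣ × ℤˣ :=
    { toFun := fun x => ((-1) ^ x.toAdd.1.val, (-1) ^ x.toAdd.2.1.val, (-1) ^ x.toAdd.2.2.val)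
      map_one' := by decide
      map_mul' := by decide +kernel }
  have hf : Function.Bijective f := by decide +kernel
  exact ⟨(MulEquiv.ofBijective f hf).symm⟩

/-- Reindexing matrices by `Fin 4`. -/
def reindexGL : GL (Fin 2 × Fin 2) ℤ ≃* GL (Fin 4) ℤ :=
  Units.mapEquiv (Matrix.reindexRingEquiv ℤ finProdFinEquiv).toMulEquiv

theorem reindexGL_mem (M : GL (Fin 2 × Fin 2) ℤ) :
    reindexGL M ∈ hypOrthogonal ↔ M.1ᵀ * Qmat 2 * M.1 = Qmat 2 := by
  have hQ : hypGram = Matrix.reindexRingEquiv ℤ finProdFinEquiv (Qmat 2) := by decide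
  change (Matrix.reindexRingEquiv ℤ finProdFinEquiv M.1)ᵀ * hypGram *
    Matrix.reindexRingEquiv ℤ finProdFinEquiv M.1 = hypGram ↔ _
  have hT : (Matrix.reindexRingEquiv ℤ finProdFinEquiv M.1)ᵀ =
    Matrix.reindexRingEquiv ℤ finProdFinEquiv M.1ᵀ := rfl
  rw [hT, hQ, ← map_mul, ← map_mul, (Matrix.reindexRingEquiv ℤ finProdFinEquiv).injective.eq_iff]

/-- The abelianisation of `O_{2,2}(ℤ)` (the subgroup of `GL₄(ℤ)` of matrices `M` with
`MᵀQM = Q`) is isomorphic to `(ℤ/2) × (ℤ/2) × (ℤ/2)`. -/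
theorem abelianization_O22 (H : Subgroup (Matrix.GeneralLinearGroup (Fin 2 × Fin 2) ℤ))
    (hH : ∀ M : Matrix.GeneralLinearGroup (Fin 2 × Fin 2) ℤ,
      M ∈ H ↔ (M : Matrix (Fin 2 × Fin 2) (Fin 2 × Fin 2) ℤ)ᵀ * Qmat 2
        * (M : Matrix (Fin 2 × Fin 2) (Fin 2 × Fin 2) ℤ) = Qmat 2) :
    Nonempty (Abelianization H ≃* Multiplicative (ZMod 2 × ZMod 2 × ZMod 2)) := by
  have h : H.map (reindexGL : GL (Fin 2 × Fin 2) ℤ →* GL (Fin 4) ℤ) = hypOrthogonal := by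
    rw [show H = hypOrthogonal.comap (reindexGL : GL (Fin 2 × Fin 2) ℤ →* GL (Fin 4) ℤ) from
      Subgroup.ext fun M => (hH M).trans (reindexGL_mem M).symm]
    exact Subgroup.map_comap_eq_self_of_surjective reindexGL.surjective _
  obtain ⟨e⟩ := nonempty_intUnits_mulEquiv
  exact ⟨((reindexGL.subgroupMap H).trans (MulEquiv.subgroupCongr h)).abelianizationCongr.trans
    ((MulEquiv.ofBijective _ hypOrthogonal.lift_characters_bijective).trans e)⟩
end

section
/- For every g ≥ 3, the composite of the stabilisation homomorphism O_{1,1}(ℤ) → O_{g,g}(ℤ), M ↦ M ⊕ I_{2g−2} (block sum with the identity, with respect to the block-diagonal hyperbolic Gram matrix), with the quotient map O_{g,g}(ℤ) → Abelianisation(O_{g,g}(ℤ)) is surjective. -/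
open Matrix

/-- Stabilisation: the block sum `M ⊕ I_{2g-2}` of a `2 × 2` matrix `M` (indexed by
`Fin 1 × Fin 2`) with the identity, placed in the first hyperbolic block. -/
def stabMat (g : ℕ) (M : Matrix (Fin 1 × Fin 2) (Fin 1 × Fin 2) ℤ) :
    Matrix (Fin g × Fin 2) (Fin g × Fin 2) ℤ :=
  Matrix.of fun p q =>
    if p.1.val = 0 ∧ q.1.val = 0 then M (0, p.2) (0, q.2)
    else if p = q then 1 else 0

/-- The index dual to `p`: the other index in the same hyperbolic block. -/
def dualIndex {g : ℕ} (p : Fin g × Fin 2) : Fin g × Fin 2 := (p.1, 1 - p.2)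

@[simp]
lemma dualIndex_fst {g : ℕ} (p : Fin g × Fin 2) : (dualIndex p).1 = p.1 := rfl

@[simp]
lemma dualIndex_dualIndex {g : ℕ} (p : Fin g × Fin 2) : dualIndex (dualIndex p) = p := by
  simp [dualIndex]

lemma dualIndex_ne {g : ℕ} (p : Fin g × Fin 2) : dualIndex p ≠ p := by
  obtain ⟨i, s⟩ := p
  simp only [dualIndex, ne_eq, Prod.mk.injEq, true_and]
  revert s
  decide

lemma dualIndex_eq_iff {g : ℕ} (p q : Fin g × Fin 2) : dualIndex p = q ↔ p = dualIndex q :=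
  ⟨fun h => by rw [← h, dualIndex_dualIndex], fun h => by rw [h, dualIndex_dualIndex]⟩

lemma eq_or_eq_dualIndex {g : ℕ} {p q : Fin g × Fin 2} (h : p.1 = q.1) :
    p = q ∨ p = dualIndex q := by
  obtain ⟨i, s⟩ := p
  obtain ⟨j, t⟩ := q
  obtain rfl : i = j := h
  simp only [dualIndex, Prod.mk.injEq, true_and]
  revert s t
  decide

lemma Qmat_apply {g : ℕ} (p q : Fin g × Fin 2) :
    Qmat g p q = if p = dualIndex q then 1 else 0 := by
  have : (p.1 = q.1 ∧ p.2 ≠ q.2) ↔ p = dualIndex q := by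
    obtain ⟨i, s⟩ := p
    obtain ⟨j, t⟩ := q
    simp only [dualIndex, Prod.mk.injEq, ne_eq, and_congr_right_iff]
    intro _
    revert s t
    decide
  simp [Qmat, this]

lemma Qmat_mul_apply {g : ℕ} (A : Matrix (Fin g × Fin 2) (Fin g × Fin 2) ℤ)
    (p q : Fin g × Fin 2) : (Qmat g * A) p q = A (dualIndex p) q := by
  simp [Matrix.mul_apply, Qmat_apply, ← dualIndex_eq_iff]

lemma mul_Qmat_apply {g : ℕ} (A : Matrix (Fin g × Fin 2) (Fin g × Fin 2) ℤ)
    (p q : Fin g × Fin 2) : (A * Qmat g) p q = A p (dualIndex q) := by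
  simp [Matrix.mul_apply, Qmat_apply]

/-- The matrix preserves the hyperbolic form. -/
def PreservesQ {g : ℕ} (A : Matrix (Fin g × Fin 2) (Fin g × Fin 2) ℤ) : Prop :=
  Aᵀ * Qmat g * A = Qmat g

lemma PreservesQ.mul {g : ℕ} {A B : Matrix (Fin g × Fin 2) (Fin g × Fin 2) ℤ}
    (hA : PreservesQ A) (hB : PreservesQ B) : PreservesQ (A * B) := by
  unfold PreservesQ at *
  calc (A * B)ᵀ * Qmat g * (A * B) = Bᵀ * (Aᵀ * Qmat g * A) * B := by
        simp only [Matrix.transpose_mul, Matrix.mul_assoc]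
    _ = Qmat g := by rw [hA, hB]

lemma PreservesQ.sum_mul {g : ℕ} {A : Matrix (Fin g × Fin 2) (Fin g × Fin 2) ℤ}
    (hA : PreservesQ A) (a b : Fin g × Fin 2) :
    ∑ k, A k a * A (dualIndex k) b = if a = dualIndex b then 1 else 0 := by
  rw [← Qmat_apply, ← congrFun (congrFun hA a) b, Matrix.mul_assoc, Matrix.mul_apply]
  simp [Qmat_mul_apply]

/-- If a column of an isometry is supported at one index, it pairs with any other column through
that index alone. -/
lemma PreservesQ.mul_of_column {g : ℕ} {A : Matrix (Fin g × Fin 2) (Fin g × Fin 2) ℤ}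
    (hA : PreservesQ A) {p r : Fin g × Fin 2} (h : ∀ a, a ≠ p → A a r = 0)
    (b : Fin g × Fin 2) :
    A p r * A (dualIndex p) b = if r = dualIndex b then 1 else 0 := by
  rw [← hA.sum_mul, Finset.sum_eq_single p]
  · intro a _ ha
    simp [h a ha]
  · simp

/-- The columns of an isometry are isotropic; here for a column supported in one block. -/
lemma PreservesQ.mul_dualIndex_eq_zero {g : ℕ}
    {A : Matrix (Fin g × Fin 2) (Fin g × Fin 2) ℤ}
    (hA : PreservesQ A) {p r : Fin g × Fin 2} (h : ∀ a, a.1 ≠ p.1 → A a r = 0) :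
    A p r * A (dualIndex p) r = 0 := by
  have h1 := hA.sum_mul r r
  rw [if_neg (dualIndex_ne r).symm,
    Finset.sum_eq_add p (dualIndex p) (dualIndex_ne p).symm] at h1
  · simp only [dualIndex_dualIndex] at h1
    linarith
  · intro a _ ha
    rw [h a, zero_mul]
    intro h2
    rcases eq_or_eq_dualIndex h2 with h3 | h3
    · exact ha.1 h3
    · exact ha.2 h3
  · simp
  · simp

/-- The difference of matrix units spanning the root space of the elementary matrices. -/
def rootMat {g : ℕ} (p q : Fin g × Fin 2) : Matrix (Fin g × Fin 2) (Fin g × Fin 2) ℤ :=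
  Matrix.single p q 1 - Matrix.single (dualIndex q) (dualIndex p) 1

/-- The elementary orthogonal matrix attached to two indices in different blocks. -/
def elemMat {g : ℕ} (p q : Fin g × Fin 2) (t : ℤ) :
    Matrix (Fin g × Fin 2) (Fin g × Fin 2) ℤ :=
  1 + t • rootMat p q

lemma elemMat_mul_apply {g : ℕ} (p q : Fin g × Fin 2) (t : ℤ)
    (A : Matrix (Fin g × Fin 2) (Fin g × Fin 2) ℤ) (a b : Fin g × Fin 2) :
    (elemMat p q t * A) a b = A a b + t * ((if a = p then A q b else 0)
      - if a = dualIndex q then A (dualIndex p) b else 0) := by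
  simp only [elemMat, rootMat, Matrix.add_mul, Matrix.one_mul, Matrix.smul_mul, Matrix.sub_mul,
    Matrix.add_apply, Matrix.smul_apply, Matrix.sub_apply, smul_eq_mul]
  congr 3
  · split_ifs with h
    · subst h; simp
    · simp [Matrix.single_mul_apply_of_ne, h]
  · split_ifs with h
    · subst h; simp
    · simp [Matrix.single_mul_apply_of_ne, h]

lemma dualIndex_ne_of_fst_ne {g : ℕ} {p q : Fin g × Fin 2} (h : p.1 ≠ q.1) :
    dualIndex p ≠ q := fun h' => h (by rw [← h', dualIndex_fst])

lemma rootMat_mul_self {g : ℕ} {p q : Fin g × Fin 2} (h : p.1 ≠ q.1) :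
    rootMat p q * rootMat p q = 0 := by
  have h1 : q ≠ p := fun h' => h (by rw [h'])
  have h2 : dualIndex p ≠ dualIndex q := fun h' => h (by simpa using congrArg Prod.fst h')
  simp [rootMat, Matrix.sub_mul, Matrix.mul_sub, Matrix.single_mul_single_of_ne, h1, h2,
    dualIndex_ne, (dualIndex_ne _).symm]

lemma elemMat_mul_elemMat_neg {g : ℕ} {p q : Fin g × Fin 2} (h : p.1 ≠ q.1) (t : ℤ) :
    elemMat p q t * elemMat p q (-t) = 1 := by
  simp only [elemMat, Matrix.add_mul, Matrix.mul_add, Matrix.one_mul, Matrix.mul_one,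
    Matrix.smul_mul, Matrix.mul_smul, Matrix.mul_neg, rootMat_mul_self h, smul_zero, neg_smul]
  simp

/-- The Steinberg relation between elementary orthogonal matrices. -/
lemma elemMat_mul_elemMat {g : ℕ} {p q r : Fin g × Fin 2} (hpq : p.1 ≠ q.1) (hqr : q.1 ≠ r.1)
    (hpr : p.1 ≠ r.1) (t : ℤ) :
    elemMat p q t * elemMat q r 1 = elemMat p r t * (elemMat q r 1 * elemMat p q t) := by
  have ne {a b : Fin g × Fin 2} (h : a.1 ≠ b.1) : a ≠ b := fun h' => h (by rw [h'])
  have hXY : rootMat p q * rootMat q r = Matrix.single p r 1 := by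
    simp [rootMat, Matrix.sub_mul, Matrix.mul_sub, Matrix.single_mul_single_of_ne,
      ne (a := dualIndex p) (b := q) hpq, ne (a := dualIndex p) (b := dualIndex r) hpr,
      ne (a := q) (b := dualIndex r) hqr]
  have hYX : rootMat q r * rootMat p q = Matrix.single (dualIndex r) (dualIndex p) 1 := by
    simp [rootMat, Matrix.sub_mul, Matrix.mul_sub, Matrix.single_mul_single_of_ne,
      ne (a := r) (b := p) hpr.symm, ne (a := r) (b := dualIndex q) hqr.symm,
      ne (a := dualIndex q) (b := p) hpq.symm]
  have hZY : rootMat p r * rootMat q r = 0 := by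
    simp [rootMat, Matrix.sub_mul, Matrix.mul_sub, Matrix.single_mul_single_of_ne,
      (dualIndex_ne _).symm, ne hqr.symm, ne (a := dualIndex p) (b := q) hpq,
      ne (a := dualIndex p) (b := dualIndex r) hpr]
  have hZX : rootMat p r * rootMat p q = 0 := by
    simp [rootMat, Matrix.sub_mul, Matrix.mul_sub, Matrix.single_mul_single_of_ne,
      dualIndex_ne, ne hpr.symm, ne (a := r) (b := dualIndex q) hqr.symm,
      ne (a := dualIndex p) (b := dualIndex q) hpq]
  have hZ : rootMat p r = rootMat p q * rootMat q r - rootMat q r * rootMat p q := by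
    rw [hXY, hYX, rootMat]
  have hZYX : rootMat p r * (rootMat q r * rootMat p q) = 0 := by
    rw [← Matrix.mul_assoc, hZY, Matrix.zero_mul]
  simp only [elemMat, Matrix.add_mul, Matrix.mul_add, Matrix.one_mul, Matrix.mul_one,
    Matrix.smul_mul, Matrix.mul_smul, hZY, hZX, hZYX, one_smul]
  rw [hZ]
  simp only [smul_sub, smul_add, smul_zero]
  abel

lemma preservesQ_elemMat {g : ℕ} {p q : Fin g × Fin 2} (h : p.1 ≠ q.1) (t : ℤ) :
    PreservesQ (elemMat p q t) := by
  have key : (elemMat p q t)ᵀ * Qmat g = Qmat g * elemMat p q (-t) := by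
    ext a b
    rw [mul_Qmat_apply, Qmat_mul_apply, Matrix.transpose_apply]
    have hone : dualIndex b = a ↔ dualIndex a = b := by rw [dualIndex_eq_iff, eq_comm]
    have hroot (a b : Fin g × Fin 2) :
        (dualIndex q = dualIndex a ∧ dualIndex p = b) ↔ (p = dualIndex b ∧ q = a) := by
      rw [dualIndex_eq_iff, dualIndex_dualIndex, dualIndex_eq_iff, and_comm]
    simp only [elemMat, rootMat, Matrix.add_apply, Matrix.smul_apply, Matrix.sub_apply,
      Matrix.one_apply, Matrix.single_apply, smul_eq_mul, hone, hroot]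
    ring
  unfold PreservesQ
  have h2 := elemMat_mul_elemMat_neg h (-t)
  rw [neg_neg] at h2
  rw [key, Matrix.mul_assoc, h2, Matrix.mul_one]

/-- The monoid generated by elementary orthogonal matrices supported in the first `n` blocks. -/
def elemMonoid (g n : ℕ) : Submonoid (Matrix (Fin g × Fin 2) (Fin g × Fin 2) ℤ) :=
  Submonoid.closure {E | ∃ p q t, p.1 ≠ q.1 ∧ p.1.val < n ∧ q.1.val < n ∧ E = elemMat p q t}

lemma elemMat_mem {g n : ℕ} {p q : Fin g × Fin 2} (h : p.1 ≠ q.1) (hp : p.1.val < n)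
    (hq : q.1.val < n) (t : ℤ) : elemMat p q t ∈ elemMonoid g n :=
  Submonoid.subset_closure ⟨p, q, t, h, hp, hq, rfl⟩

lemma elemMonoid_mono (g : ℕ) {m n : ℕ} (h : m ≤ n) : elemMonoid g m ≤ elemMonoid g n := by
  apply Submonoid.closure_mono
  rintro E ⟨p, q, t, h1, h2, h3, rfl⟩
  exact ⟨p, q, t, h1, h2.trans_le h, h3.trans_le h, rfl⟩

lemma preservesQ_of_mem {g n : ℕ} {E : Matrix (Fin g × Fin 2) (Fin g × Fin 2) ℤ}
    (hE : E ∈ elemMonoid g n) : PreservesQ E := by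
  induction hE using Submonoid.closure_induction with
  | mem E h => obtain ⟨p, q, t, h, -, -, rfl⟩ := h; exact preservesQ_elemMat h t
  | one => simp [PreservesQ]
  | mul E F _ _ hE hF => exact hE.mul hF

/-- The matrix agrees with the identity outside the first `n` blocks. -/
def FixedFrom {g : ℕ} (n : ℕ) (A : Matrix (Fin g × Fin 2) (Fin g × Fin 2) ℤ) : Prop :=
  ∀ a b : Fin g × Fin 2, n ≤ a.1.val ∨ n ≤ b.1.val → A a b = if a = b then 1 else 0

lemma FixedFrom.mul_left {g n : ℕ} {A E : Matrix (Fin g × Fin 2) (Fin g × Fin 2) ℤ}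
    (hA : FixedFrom n A) (hE : E ∈ elemMonoid g n) : FixedFrom n (E * A) := by
  induction hE using Submonoid.closure_induction generalizing A with
  | mem E h =>
    obtain ⟨p, q, t, h, hp, hq, rfl⟩ := h
    intro a b hab
    rw [elemMat_mul_apply, hA a b hab]
    have h1 : (if a = p then A q b else 0) = 0 := by
      split_ifs with h
      · subst h
        have hb : n ≤ b.1.val := by omega
        rw [hA q b (Or.inr hb), if_neg]
        rintro rfl
        omega
      · rfl
    have h2 : (if a = dualIndex q then A (dualIndex p) b else 0) = 0 := by
      split_ifs with h
      · subst h
        have hb : n ≤ b.1.val := by simp only [dualIndex_fst] at hab; omega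
        rw [hA _ b (Or.inr hb), if_neg]
        rintro rfl
        simp only [dualIndex_fst] at hb
        omega
      · rfl
    rw [h1, h2]
    ring
  | one => rwa [Matrix.one_mul]
  | mul E F _ _ hE hF =>
    rw [Matrix.mul_assoc]
    exact hE (hF hA)

/-- Adding multiples of row `p` to rows in other blocks, at the cost of changing row
`dualIndex p`. -/
lemma exists_elem_add_rows {g n : ℕ} {p : Fin g × Fin 2} (hp : p.1.val < n)
    (t : Fin g × Fin 2 → ℤ) (s : Finset (Fin g × Fin 2))
    (hs : ∀ q ∈ s, q.1 ≠ p.1 ∧ q.1.val < n) (A : Matrix (Fin g × Fin 2) (Fin g × Fin 2) ℤ) :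
    ∃ E ∈ elemMonoid g n, ∀ a b, a ≠ dualIndex p →
      (E * A) a b = A a b + if a ∈ s then t a * A p b else 0 := by
  induction s using Finset.induction_on with
  | empty => exact ⟨1, one_mem _, by simp⟩
  | insert q s hq ih =>
    obtain ⟨E, hE, h⟩ := ih fun a ha => hs a (Finset.mem_insert_of_mem ha)
    obtain ⟨hqp, hqn⟩ := hs q (Finset.mem_insert_self q s)
    refine ⟨elemMat q p (t q) * E, mul_mem (elemMat_mem hqp hqn hp _) hE, ?_⟩
    intro a b ha
    have hps : p ∉ s := fun hps => (hs p (Finset.mem_insert_of_mem hps)).1 rfl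
    rw [Matrix.mul_assoc, elemMat_mul_apply, if_neg ha, h a b ha,
      h p b (dualIndex_ne p).symm, if_neg hps]
    by_cases haq : a = q
    · subst haq
      simp [hq]
    · simp [haq]

/-- Clearing a column outside the block of `p`, when its entry at `p` divides the others. -/
lemma exists_elem_clear {g n : ℕ} {p r : Fin g × Fin 2} (hp : p.1.val < n) (hr : r.1.val < n)
    {A : Matrix (Fin g × Fin 2) (Fin g × Fin 2) ℤ} (hA : FixedFrom n A)
    (hdvd : ∀ q : Fin g × Fin 2, q.1 ≠ p.1 → A p r ∣ A q r) :
    ∃ E ∈ elemMonoid g n, (∀ b, (E * A) p b = A p b) ∧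
      (∀ a, a.1 ≠ p.1 → (E * A) a r = 0) ∧
      ∀ a b, a.1 ≠ p.1 → A p b = 0 → (E * A) a b = A a b := by
  choose! c hc using hdvd
  obtain ⟨E, hE, h⟩ := exists_elem_add_rows hp (fun q => -c q)
    (Finset.univ.filter fun q => q.1 ≠ p.1 ∧ q.1.val < n) (by simp) A
  refine ⟨E, hE, fun b => ?_, fun a ha => ?_, fun a b ha hb => ?_⟩
  · rw [h p b (dualIndex_ne p).symm]
    simp
  · rw [h a r fun h' => ha (by rw [h', dualIndex_fst])]
    by_cases han : a.1.val < n
    · simp only [Finset.mem_filter, Finset.mem_univ, ha, han, ne_eq, not_false_eq_true,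
        and_self, if_true]
      rw [hc a ha]
      ring
    · have h1 : A a r = 0 := by
        rw [hA a r (Or.inl (by omega)), if_neg]
        rintro rfl
        exact han hr
      simp [han, h1]
  · rw [h a b fun h' => ha (by rw [h', dualIndex_fst])]
    simp [hb]

/-- Moving a signed basis column to a basis column in another block. -/
lemma exists_elem_move {g n : ℕ} {p q r : Fin g × Fin 2} (hp : p.1.val < n) (hq : q.1.val < n)
    (hpq : p.1 ≠ q.1) {A : Matrix (Fin g × Fin 2) (Fin g × Fin 2) ℤ}
    (hA : ∀ a, a ≠ p → A a r = 0) (hc : A p r * A p r = 1) :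
    ∃ E ∈ elemMonoid g n, ∀ a, (E * A) a r = if a = q then 1 else 0 := by
  have ne {a b : Fin g × Fin 2} (h : a.1 ≠ b.1) : a ≠ b := fun h' => h (by rw [h'])
  have h1 : A (dualIndex q) r = 0 := hA _ (ne (a := dualIndex q) hpq.symm)
  have h2 : A (dualIndex p) r = 0 := hA _ (dualIndex_ne p)
  have h3 : A q r = 0 := hA _ (ne hpq.symm)
  refine ⟨elemMat p q (-A p r) * elemMat q p (A p r),
    mul_mem (elemMat_mem hpq hp hq _) (elemMat_mem hpq.symm hq hp _), fun a => ?_⟩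
  have hpq' := ne hpq
  have h4 : q ≠ dualIndex p := ne (b := dualIndex p) hpq.symm
  have h5 : dualIndex p ≠ q := dualIndex_ne_of_fst_ne hpq
  rw [Matrix.mul_assoc]
  simp only [elemMat_mul_apply, h1, h2, h3, h4, h5, if_true, if_false, ite_self]
  by_cases hap : a = p
  · subst hap
    simp [hpq', hc]
  · by_cases haq : a = q
    · subst haq
      simp [hap, hc, h3]
    · simp [hap, haq, hA a hap]

lemma exists_elem_column {g n : ℕ} {r : Fin g × Fin 2} (hr : r.1.val < n)
    (hn : ∃ i : Fin g, i.val < n ∧ i ≠ r.1)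
    {A : Matrix (Fin g × Fin 2) (Fin g × Fin 2) ℤ} (hA : PreservesQ A) (hF : FixedFrom n A) :
    ∃ E ∈ elemMonoid g n, ∀ a, (E * A) a r = if a = r then 1 else 0 := by
  suffices H : ∀ m : ℕ, ∀ A : Matrix (Fin g × Fin 2) (Fin g × Fin 2) ℤ, PreservesQ A →
      FixedFrom n A → ∀ p : Fin g × Fin 2, p.1.val < n → A p r ≠ 0 → (A p r).natAbs = m →
      ∃ E ∈ elemMonoid g n, ∀ a, (E * A) a r = if a = r then 1 else 0 by
    obtain ⟨p, hp⟩ : ∃ p, A p r ≠ 0 := by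
      by_contra! h
      have := hA.sum_mul r (dualIndex r)
      simp [h] at this
    refine H _ A hA hF p ?_ hp rfl
    by_contra! hpn
    apply hp
    rw [hF p r (Or.inl hpn), if_neg]
    rintro rfl
    omega
  intro m
  induction m using Nat.strong_induction_on with
  | _ m ih =>
  intro A hA hF p hp hp0 hm
  by_cases hdvd : ∀ q : Fin g × Fin 2, q.1 ≠ p.1 → A p r ∣ A q r
  · obtain ⟨E, hE, hEp, hE0, -⟩ := exists_elem_clear hp hr hF hdvd
    have hB : PreservesQ (E * A) := (preservesQ_of_mem hE).mul hA
    have h0 : ∀ a, a ≠ p → (E * A) a r = 0 := by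
      intro a ha
      by_cases hap : a.1 = p.1
      · obtain rfl := (eq_or_eq_dualIndex hap).resolve_left ha
        have := hB.mul_dualIndex_eq_zero hE0
        rw [hEp] at this
        exact (mul_eq_zero.mp this).resolve_left hp0
      · exact hE0 a hap
    have hc : (E * A) p r * (E * A) p r = 1 := by
      have h1 := hB.mul_of_column h0 (dualIndex r)
      rw [if_pos (dualIndex_dualIndex r).symm] at h1
      exact Int.isUnit_mul_self (IsUnit.of_mul_eq_one _ h1)
    by_cases hpr : p.1 = r.1
    · obtain ⟨i, hi, hir⟩ := hn
      obtain ⟨F, hFm, h1⟩ := exists_elem_move (q := (i, 0)) hp hi (by rw [hpr]; exact hir.symm)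
        h0 hc
      obtain ⟨G, hG, h2⟩ := exists_elem_move (p := (i, 0)) (q := r) (r := r) (A := F * (E * A))
        hi hr hir (fun a ha => by rw [h1, if_neg ha]) (by simp [h1])
      exact ⟨G * (F * E), mul_mem hG (mul_mem hFm hE), by simpa [Matrix.mul_assoc] using h2⟩
    · obtain ⟨F, hFm, h1⟩ := exists_elem_move hp hr hpr h0 hc
      exact ⟨F * E, mul_mem hFm hE, by simpa [Matrix.mul_assoc] using h1⟩
  · push Not at hdvd
    obtain ⟨q, hqp, hq⟩ := hdvd
    have hqn : q.1.val < n := by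
      by_contra! hqn
      apply hq
      rw [hF q r (Or.inl hqn), if_neg]
      · exact dvd_zero _
      · rintro rfl
        omega
    have hE := elemMat_mem hqp hqn hp (-(A q r / A p r))
    have hval : (elemMat q p (-(A q r / A p r)) * A) q r = A q r % A p r := by
      rw [elemMat_mul_apply, if_pos rfl, if_neg (dualIndex_ne_of_fst_ne hqp.symm).symm,
        Int.emod_def]
      ring
    obtain ⟨F, hFm, h1⟩ := ih (A q r % A p r).natAbs
      (by
        have h2 := Int.emod_nonneg (A q r) hp0
        have h3 := Int.emod_lt_abs (A q r) hp0
        rw [Int.abs_eq_natAbs] at h3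
        omega)
      _ ((preservesQ_of_mem hE).mul hA) (hF.mul_left hE) q hqn
      (by rw [hval]; exact fun h => hq (Int.dvd_of_emod_eq_zero h)) (by rw [hval])
    exact ⟨F * _, mul_mem hFm hE, by simpa [Matrix.mul_assoc] using h1⟩

lemma exists_elem_fixedFrom_pred {g n : ℕ} (hn : 1 ≤ n) (hng : n < g)
    {A : Matrix (Fin g × Fin 2) (Fin g × Fin 2) ℤ} (hA : PreservesQ A)
    (hF : FixedFrom (n + 1) A) :
    ∃ E ∈ elemMonoid g (n + 1), FixedFrom n (E * A) := by
  obtain ⟨r, hr⟩ : ∃ r : Fin g × Fin 2, r.1.val = n := ⟨(⟨n, hng⟩, 0), rfl⟩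
  have hrn : r.1.val < n + 1 := by omega
  obtain ⟨E, hE, h1⟩ := exists_elem_column hrn
    ⟨⟨0, by omega⟩, by simp, fun h => by rw [← h] at hr; simp at hr; omega⟩ hA hF
  have hB := (preservesQ_of_mem hE).mul hA
  have hBF := hF.mul_left hE
  generalize hBdef : E * A = B at *
  have hrow : ∀ b, B (dualIndex r) b = if r = dualIndex b then 1 else 0 := by
    intro b
    have := hB.mul_of_column (p := r) (fun a ha => by rw [h1, if_neg ha]) b
    rwa [h1, if_pos rfl, one_mul] at this
  have hrr : B (dualIndex r) (dualIndex r) = 1 := by simp [hrow]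
  obtain ⟨F, hFm, hp, h0, hfix⟩ := exists_elem_clear (p := dualIndex r) (r := dualIndex r)
    hrn hrn hBF (fun q _ => by rw [hrr]; exact one_dvd _)
  refine ⟨F * E, mul_mem hFm hE, ?_⟩
  rw [Matrix.mul_assoc, hBdef]
  have hC := (preservesQ_of_mem hFm).mul hB
  have hCF := hBF.mul_left hFm
  generalize F * B = C at *
  have hrow' : ∀ b, C (dualIndex r) b = if r = dualIndex b then 1 else 0 := fun b => by
    rw [hp, hrow]
  have hcol' : ∀ a, a ≠ dualIndex r → C a (dualIndex r) = 0 := by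
    intro a ha
    by_cases har : a.1 = r.1
    · obtain rfl := (eq_or_eq_dualIndex har).resolve_right ha
      have := hC.mul_dualIndex_eq_zero h0
      simpa [hrow'] using this
    · exact h0 a har
  have hrow : ∀ b, C r b = if dualIndex r = dualIndex b then 1 else 0 := by
    intro b
    have := hC.mul_of_column hcol' b
    simpa [hrow'] using this
  have hcol : ∀ a, a ≠ r → C a r = 0 := by
    intro a ha
    by_cases har : a.1 = r.1
    · obtain rfl := (eq_or_eq_dualIndex har).resolve_left ha
      simp [hrow', (dualIndex_ne r).symm]
    · rw [hfix a r har, h1, if_neg ha]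
      simp [h1, dualIndex_ne]
  have hdual : ∀ a b : Fin g × Fin 2, dualIndex a = dualIndex b ↔ a = b := fun a b => by
    rw [dualIndex_eq_iff, dualIndex_dualIndex]
  intro a b hab
  by_cases hab' : n + 1 ≤ a.1.val ∨ n + 1 ≤ b.1.val
  · exact hCF a b hab'
  · have : a.1 = r.1 ∨ b.1 = r.1 := by
      simp only [Fin.ext_iff]
      omega
    rcases this with h | h
    · rcases eq_or_eq_dualIndex h with rfl | rfl
      · rw [hrow]
        simp [hdual]
      · rw [hrow']
        simp [dualIndex_eq_iff]
    · rcases eq_or_eq_dualIndex h with rfl | rfl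
      · split_ifs with hab2
        · rw [hab2, hrow]; simp
        · exact hcol a hab2
      · split_ifs with hab2
        · rw [hab2, hrow']; simp
        · exact hcol' a hab2

/-- Left multiplication by elementary matrices reduces any isometry to one supported in the first
hyperbolic block. -/
lemma exists_elem_fixedFrom_one {g n : ℕ} (hn : 1 ≤ n) (hng : n ≤ g)
    {A : Matrix (Fin g × Fin 2) (Fin g × Fin 2) ℤ} (hA : PreservesQ A) (hF : FixedFrom n A) :
    ∃ E ∈ elemMonoid g n, FixedFrom 1 (E * A) := by
  induction n, hn using Nat.le_induction generalizing A with
  | base => exact ⟨1, one_mem _, by rwa [Matrix.one_mul]⟩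
  | succ n hn ih =>
    obtain ⟨E, hE, h1⟩ := exists_elem_fixedFrom_pred hn hng hA hF
    obtain ⟨F, hFm, h2⟩ := ih (by omega) ((preservesQ_of_mem hE).mul hA) h1
    exact ⟨F * E, mul_mem (elemMonoid_mono g (Nat.le_succ n) hFm) hE, by
      rwa [Matrix.mul_assoc]⟩

/-- The elementary orthogonal matrix as an invertible matrix. -/
def elemGL {g : ℕ} {p q : Fin g × Fin 2} (h : p.1 ≠ q.1) (t : ℤ) :
    Matrix.GeneralLinearGroup (Fin g × Fin 2) ℤ where
  val := elemMat p q t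
  inv := elemMat p q (-t)
  val_inv := elemMat_mul_elemMat_neg h t
  inv_val := by simpa using elemMat_mul_elemMat_neg h (-t)

/-- For at least three blocks, elementary matrices are trivial in the abelianisation. -/
lemma exists_lift_of_mem_elemMonoid {g n : ℕ} (hg : 3 ≤ g)
    (H : Subgroup (Matrix.GeneralLinearGroup (Fin g × Fin 2) ℤ))
    (hH : ∀ M : Matrix.GeneralLinearGroup (Fin g × Fin 2) ℤ, M ∈ H ↔
      PreservesQ (M : Matrix (Fin g × Fin 2) (Fin g × Fin 2) ℤ))
    {E : Matrix (Fin g × Fin 2) (Fin g × Fin 2) ℤ} (hE : E ∈ elemMonoid g n) :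
    ∃ N : H, ((N : Matrix.GeneralLinearGroup (Fin g × Fin 2) ℤ)
      : Matrix (Fin g × Fin 2) (Fin g × Fin 2) ℤ) = E ∧ Abelianization.of N = 1 := by
  induction hE using Submonoid.closure_induction with
  | mem E h =>
    obtain ⟨p, r, t, hpr, -, -, rfl⟩ := h
    obtain ⟨i, hi⟩ : ∃ i : Fin g, i ∉ ({p.1, r.1} : Finset (Fin g)) := by
      by_contra! h
      have h1 := Finset.card_le_card (fun i _ => h i : Finset.univ ⊆ ({p.1, r.1} : Finset (Fin g)))
      have h2 := Finset.card_le_two (a := p.1) (b := r.1)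
      rw [Finset.card_univ, Fintype.card_fin] at h1
      omega
    simp only [Finset.mem_insert, Finset.mem_singleton, not_or] at hi
    have hpq : p.1 ≠ ((i, 0) : Fin g × Fin 2).1 := fun h => hi.1 h.symm
    have hqr : ((i, 0) : Fin g × Fin 2).1 ≠ r.1 := hi.2
    let lift {a b : Fin g × Fin 2} (h : a.1 ≠ b.1) (s : ℤ) : H :=
      ⟨elemGL h s, (hH _).2 (preservesQ_elemMat h s)⟩
    refine ⟨lift hpr t, rfl, ?_⟩
    have key : lift hpq t * lift hqr 1 = lift hpr t * (lift hqr 1 * lift hpq t) :=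
      Subtype.ext (Units.ext (elemMat_mul_elemMat hpq hqr hpr t))
    have h1 := congrArg Abelianization.of key
    rw [map_mul, map_mul, map_mul, mul_comm (Abelianization.of (lift hqr 1))] at h1
    exact right_eq_mul.mp h1
  | one => exact ⟨1, rfl, map_one _⟩
  | mul E F _ _ hE hF =>
    obtain ⟨N, rfl, hN⟩ := hE
    obtain ⟨N', rfl, hN'⟩ := hF
    exact ⟨N * N', rfl, by rw [map_mul, hN, hN', one_mul]⟩

/-- An isometry supported in the first block is the stabilisation of an isometry of rank two. -/
lemma exists_stabMat_eq {g : ℕ} (hg : 0 < g)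
    {A : Matrix (Fin g × Fin 2) (Fin g × Fin 2) ℤ} (hA : PreservesQ A) (hF : FixedFrom 1 A) :
    ∃ M : Matrix (Fin 1 × Fin 2) (Fin 1 × Fin 2) ℤ, Mᵀ * Qmat 1 * M = Qmat 1 ∧
      A = stabMat g M := by
  refine ⟨Matrix.of fun a b => A (⟨0, hg⟩, a.2) (⟨0, hg⟩, b.2), ?_, ?_⟩
  · ext ⟨i, a⟩ ⟨j, b⟩
    obtain rfl := Subsingleton.elim i 0
    obtain rfl := Subsingleton.elim j 0
    have h := hA.sum_mul (⟨0, hg⟩, a) (⟨0, hg⟩, b)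
    rw [Fintype.sum_prod_type, Finset.sum_eq_single ⟨0, hg⟩] at h
    · rw [Matrix.mul_assoc, Matrix.mul_apply, Fintype.sum_prod_type]
      simp only [Qmat_mul_apply, Matrix.transpose_apply, Matrix.of_apply, Finset.univ_unique,
        Finset.sum_singleton, Qmat_apply]
      simpa [dualIndex] using h
    · intro k _ hk
      have hk1 : 1 ≤ k.val := by
        have : k.val ≠ 0 := fun h => hk (Fin.ext h)
        omega
      refine Finset.sum_eq_zero fun s _ => ?_
      rw [hF (k, s) _ (Or.inl hk1), if_neg, zero_mul]
      exact fun h => hk (congrArg Prod.fst h)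
    · simp
  · ext a b
    simp only [stabMat, Matrix.of_apply]
    split_ifs with h1 h2
    · have ha : a = (⟨0, hg⟩, a.2) := Prod.ext (Fin.ext h1.1) rfl
      have hb : b = (⟨0, hg⟩, b.2) := Prod.ext (Fin.ext h1.2) rfl
      rw [← ha, ← hb]
    · rw [hF a b (by omega), if_pos h2]
    · rw [hF a b (by omega), if_neg h2]

/-- For `g ≥ 3`, the composite of the stabilisation homomorphism
`O_{1,1}(ℤ) → O_{g,g}(ℤ)`, `M ↦ M ⊕ I_{2g-2}`, with the quotient map to the abelianisation of
`O_{g,g}(ℤ)` is surjective. -/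
theorem stabilisation_O11_to_abelianization_Ogg_surjective (g : ℕ) (hg : 3 ≤ g)
    (H : Subgroup (Matrix.GeneralLinearGroup (Fin g × Fin 2) ℤ))
    (hH : ∀ M : Matrix.GeneralLinearGroup (Fin g × Fin 2) ℤ,
      M ∈ H ↔ (M : Matrix (Fin g × Fin 2) (Fin g × Fin 2) ℤ)ᵀ * Qmat g
        * (M : Matrix (Fin g × Fin 2) (Fin g × Fin 2) ℤ) = Qmat g) :
    ∀ x : Abelianization H, ∃ M : Matrix (Fin 1 × Fin 2) (Fin 1 × Fin 2) ℤ,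
      Mᵀ * Qmat 1 * M = Qmat 1 ∧
      ∃ N : H, ((N : Matrix.GeneralLinearGroup (Fin g × Fin 2) ℤ)
          : Matrix (Fin g × Fin 2) (Fin g × Fin 2) ℤ) = stabMat g M ∧
        Abelianization.of N = x := by
  intro x
  obtain ⟨N, rfl⟩ := QuotientGroup.mk_surjective x
  have hN : PreservesQ ((N : Matrix.GeneralLinearGroup (Fin g × Fin 2) ℤ)
      : Matrix (Fin g × Fin 2) (Fin g × Fin 2) ℤ) := (hH N).1 N.2
  obtain ⟨E, hE, h1⟩ := exists_elem_fixedFrom_one (n := g) (by omega) le_rfl hN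
    (fun a b h => by omega)
  obtain ⟨M, hM, h2⟩ := exists_stabMat_eq (by omega) ((preservesQ_of_mem hE).mul hN) h1
  obtain ⟨N', rfl, hN'⟩ := exists_lift_of_mem_elemMonoid hg H hH hE
  refine ⟨M, hM, N' * N, h2, ?_⟩
  rw [map_mul, hN', one_mul]
  rfl
end
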